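/- arXiv:math-ph/0402025 — 2 statements merged into one kernel-verified Lean document; each statement's English description precedes it below -/
import Mathlib

section
/- For every n ∈ C⁰(P), the fields n and −n (the pointwise antipodal field x ↦ −n(x)) are not homotopic in C⁰(P): the edge orientations satisfy e^b(−n) = −e^b(n) on each truncated edge, the edge orientations are homotopy invariants, and at least one edge orientation is nonzero, so n and −n lie in distinct homotopy classes. -/
open Matrix Set MeasureTheory
open scoped Classical

noncomputable section

/-- Points of `ℝ³`. -/
abbrev V3 := Fin 3 → ℝ

/-- The unit sphere `S² ⊂ ℝ³`. -/
def sphereS : Set V3 := {x | x ⬝ᵥ x = 1}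

/-- Rodrigues rotation of `v` by angle `θ` about the unit axis `F`. -/
def rot3 (F : V3) (θ : ℝ) (v : V3) : V3 :=
  Real.cos θ • v + Real.sin θ • (crossProduct F v) + ((1 - Real.cos θ) * (F ⬝ᵥ v)) • F

/-- The point at fraction `ρ` of arclength along the shortest geodesic on the
unit sphere from `p` to `a` (for `a ≠ -p`). -/
def geo (p a : V3) (ρ : ℝ) : V3 :=
  if p = a then p
  else (Real.sin ((1 - ρ) * Real.arccos (p ⬝ᵥ a)) / Real.sin (Real.arccos (p ⬝ᵥ a))) • p +
       (Real.sin (ρ * Real.arccos (p ⬝ᵥ a)) / Real.sin (Real.arccos (p ⬝ᵥ a))) • a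

/-- `ξ` is the continuous angle lift of the tangent field `n` along the path `z`
(defined on `[0,1]`), `η ∈ (-π,π)` the smallest-magnitude angle between the endpoint
values, and `κ` the resulting kink number: `2πκ = ξ(1) - η`. -/
def IsKinkAlong (Fn : V3) (n : V3 → V3) (z : ℝ → V3) (κ : ℤ) : Prop :=
  ∃ ξ : ℝ → ℝ, ContinuousOn ξ (Set.Icc 0 1) ∧ ξ 0 = 0 ∧
    (∀ t ∈ Set.Icc (0:ℝ) 1, n (z t) = rot3 Fn (ξ t) (n (z 0))) ∧
    ∃ η : ℝ, η ∈ Set.Ioo (-Real.pi) Real.pi ∧ n (z 1) = rot3 Fn η (n (z 0)) ∧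
      2 * Real.pi * (κ : ℝ) = ξ 1 - η

/-- `z` is a `2π`-periodic parameterization of a loop around the centre `ctr`, lying in the
plane through `ctr` with normal `N`, positively oriented with respect to `N` (the angle
`θ` increases by `2π` over a period). -/
def PosLoopParam (N ctr : V3) (z : ℝ → V3) : Prop :=
  Continuous z ∧ (∀ φ, z (φ + 2 * Real.pi) = z φ) ∧
  ∃ e₁ e₂ : V3, e₁ ⬝ᵥ e₁ = 1 ∧ e₂ ⬝ᵥ e₂ = 1 ∧ e₁ ⬝ᵥ e₂ = 0 ∧ crossProduct e₁ e₂ = N ∧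
    ∃ θ r : ℝ → ℝ, Continuous θ ∧ Monotone θ ∧ (∀ φ, θ (φ + 2 * Real.pi) = θ φ + 2 * Real.pi) ∧
      (∀ φ, 0 < r φ) ∧
      ∀ φ, z φ = ctr + r φ • (Real.cos (θ φ) • e₁ + Real.sin (θ φ) • e₂)

/-- The map `S² → S²` obtained by gluing, along the equator, the map
`ν(ρ,φ) = n(ρ z(φ) + (1-ρ) ctr)` (on the upper hemisphere) with the map
`ν₀(ρ,φ) = g_ρ(-s, n(z(φ)))` (on the lower hemisphere), where `(ρ,φ)` are the polar
coordinates of the first two coordinates. -/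
def wrapMap (n : V3 → V3) (z : ℝ → V3) (ctr s : V3) : V3 → V3 := fun x =>
  if 0 ≤ x 2 then
    n ((Real.sqrt ((x 0) ^ 2 + (x 1) ^ 2)) • z (Complex.arg ((x 0 : ℂ) + (x 1 : ℂ) * Complex.I))
      + (1 - Real.sqrt ((x 0) ^ 2 + (x 1) ^ 2)) • ctr)
  else
    geo (-s) (n (z (Complex.arg ((x 0 : ℂ) + (x 1 : ℂ) * Complex.I))))
      (Real.sqrt ((x 0) ^ 2 + (x 1) ^ 2))

/-- Homotopy of maps of the unit sphere `S²` to itself. -/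
def SphHomotopic (f g : V3 → V3) : Prop :=
  ∃ H : ℝ → V3 → V3,
    ContinuousOn (fun q : ℝ × V3 => H q.1 q.2) (Set.Icc (0:ℝ) 1 ×ˢ sphereS) ∧
    (∀ t ∈ Set.Icc (0:ℝ) 1, Set.MapsTo (H t) sphereS sphereS) ∧
    (∀ x ∈ sphereS, H 0 x = f x) ∧ (∀ x ∈ sphereS, H 1 x = g x)

/-- The standard degree-`k` self-map of `S²`: in cylindrical coordinates it multiplies
the azimuthal angle by `k`, fixing the vertical coordinate. -/
def powMap (k : ℤ) : V3 → V3 := fun x =>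
  if ((x 0 : ℂ) + (x 1 : ℂ) * Complex.I) = 0 then x
  else
    ![‖(x 0 : ℂ) + (x 1 : ℂ) * Complex.I‖ *
        ((((x 0 : ℂ) + (x 1 : ℂ) * Complex.I) /
          (‖(x 0 : ℂ) + (x 1 : ℂ) * Complex.I‖ : ℂ)) ^ k).re,
      ‖(x 0 : ℂ) + (x 1 : ℂ) * Complex.I‖ *
        ((((x 0 : ℂ) + (x 1 : ℂ) * Complex.I) /
          (‖(x 0 : ℂ) + (x 1 : ℂ) * Complex.I‖ : ℂ)) ^ k).im,
      x 2]

/-- `deg` is a Brouwer degree for self-maps of `S²`: it is invariant under homotopy of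
continuous self-maps of the sphere, and assigns degree `k` to the standard map `powMap k`.
(These axioms determine `deg` uniquely on continuous self-maps of `S²`, by Hopf's theorem.) -/
def DegreeTheory (deg : (V3 → V3) → ℤ) : Prop :=
  (∀ f g : V3 → V3, ContinuousOn f sphereS → Set.MapsTo f sphereS sphereS →
      ContinuousOn g sphereS → Set.MapsTo g sphereS sphereS →
      SphHomotopic f g → deg f = deg g) ∧
  (∀ k : ℤ, deg (powMap k) = k)

/-- The pullback under `u : ℝ² → S²` of the (normalized) area 2-form of `S²`,
evaluated on the standard basis of `ℝ²`: `u ⋅ (∂₁ u × ∂₂ u)`. -/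
def pullA (u : ℝ × ℝ → V3) (p : ℝ × ℝ) : ℝ :=
  u p ⬝ᵥ crossProduct (fderiv ℝ u p (1, 0)) (fderiv ℝ u p (0, 1))

/-- The integral `∫_A n*ω` of the pullback under `n` of the area form `ω` of `S²`, over a
planar region `A` lying in the plane through `o` spanned by the orthonormal pair `e₁, e₂`
(the pair orienting the plane). -/
def faceInt (n : V3 → V3) (o e₁ e₂ : V3) (A : Set V3) : ℝ :=
  ∫ p : ℝ × ℝ in {q : ℝ × ℝ | o + q.1 • e₁ + q.2 • e₂ ∈ A},
    pullA (fun q : ℝ × ℝ => n (o + q.1 • e₁ + q.2 • e₂)) p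

/-- The 1-form `γ = (1 - cos α) dβ` on `S² - {s}` (where `(α,β)` are spherical polar
coordinates with south pole at `s`, and `e₁, e₂` is an orthonormal azimuthal frame with
`e₁ ×₃ e₂ = -s`), evaluated at the point `v` on the tangent vector `w`. -/
def gammaForm (s e₁ e₂ : V3) (v w : V3) : ℝ :=
  if (v ⬝ᵥ e₁) ^ 2 + (v ⬝ᵥ e₂) ^ 2 = 0 then 0
  else (1 + v ⬝ᵥ s) *
    (((v ⬝ᵥ e₁) * (w ⬝ᵥ e₂) - (v ⬝ᵥ e₂) * (w ⬝ᵥ e₁)) / ((v ⬝ᵥ e₁) ^ 2 + (v ⬝ᵥ e₂) ^ 2))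

/-- The closed spherical geodesic triangle with vertices `a`, `b`, `c` (pairwise
non-antipodal): the radial projection to the sphere of the planar triangle with these
vertices. Its sides are the shortest geodesic arcs joining consecutive vertices. -/
def sphTri (a b c : V3) : Set V3 :=
  {x | ∃ α β γ : ℝ, 0 ≤ α ∧ 0 ≤ β ∧ 0 ≤ γ ∧ α • a + β • b + γ • c ≠ 0 ∧
    x = (Real.sqrt ((α • a + β • b + γ • c) ⬝ᵥ (α • a + β • b + γ • c)))⁻¹ •
      (α • a + β • b + γ • c)}

/-- The shortest geodesic arc on the sphere from `a` to `b` (for `a ≠ -b`). -/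
def sphArc (a b : V3) : Set V3 :=
  {x | ∃ α β : ℝ, 0 ≤ α ∧ 0 ≤ β ∧ α • a + β • b ≠ 0 ∧
    x = (Real.sqrt ((α • a + β • b) ⬝ᵥ (α • a + β • b)))⁻¹ • (α • a + β • b)}

/-- The oriented area `A(a,b,c)` of the spherical geodesic triangle with vertices
`a`, `b`, `c`: `A = 2 arg((1 + a⋅b + b⋅c + c⋅a) + i (a×b)⋅c)`, with `arg ∈ (-π, π]`. -/
def sphA (a b c : V3) : ℝ :=
  2 * Complex.arg (((1 + a ⬝ᵥ b + b ⬝ᵥ c + c ⬝ᵥ a : ℝ) : ℂ) +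
    ((crossProduct a b ⬝ᵥ c : ℝ) : ℂ) * Complex.I)

/-- `σ(a,b,c)` relative to the point `s`: equal to `sgn((a×b)⋅s)` if `s` lies in the
spherical triangle with vertices `a`, `b`, `c`, and `0` otherwise. -/
def sphSigma (s a b c : V3) : ℝ :=
  if s ∈ sphTri a b c then Real.sign (crossProduct a b ⬝ᵥ s) else 0

/-- A compact convex polyhedron `P̄ ⊂ ℝ³` with nonempty interior: its vertices `vert`,
faces `face` (with outward unit normals `Fnormal` and supporting planes
`{x | x ⋅ Fnormal c = foffset c}`), edges `edge` (segments between vertices), together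
with the truncation data: for each vertex `a` a plane through `cpt a` with outward unit
normal `Cnormal a` separating `vert a` from the other vertices, the planes being pairwise
disjoint within `P̄`.  The combinatorial data records, for each face `c`, its `m c`
vertices `fvert c 0, fvert c 1, …` and edges `fedge c i` (from `fvert c i` to
`fvert c (i+1)`) in cyclic order, positively oriented with respect to the outward normal;
and, for each vertex `a`, its `vm a` incident edges `vedge a i` and faces `vface a i`
(with `vface a i` containing the consecutive edges `vedge a i` and `vedge a (i+1)`) in
cyclic order, positively oriented with respect to the outward normal of the cleaved face. -/
structure PolyCtx where
  nv : ℕ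
  ne : ℕ
  nf : ℕ
  Pbar : Set V3
  vert : Fin nv → V3
  face : Fin nf → Set V3
  Fnormal : Fin nf → V3
  foffset : Fin nf → ℝ
  edge : Fin ne → Set V3
  esrc : Fin ne → Fin nv
  etgt : Fin ne → Fin nv
  edgeDir : Fin ne → V3
  cpt : Fin nv → V3
  Cnormal : Fin nv → V3
  m : Fin nf → ℕ
  fvert : Fin nf → ℕ → Fin nv
  fedge : Fin nf → ℕ → Fin ne
  vm : Fin nv → ℕ
  vedge : Fin nv → ℕ → Fin ne
  vface : Fin nv → ℕ → Fin nf
  compact : IsCompact Pbar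
  convex : Convex ℝ Pbar
  int_nonempty : (interior Pbar).Nonempty
  hull : Pbar = convexHull ℝ (Set.range vert)
  vert_extreme : ∀ a, vert a ∉ convexHull ℝ (Set.range vert \ {vert a})
  vert_inj : Function.Injective vert
  Fnormal_unit : ∀ c, Fnormal c ⬝ᵥ Fnormal c = 1
  face_def : ∀ c, face c = {x ∈ Pbar | x ⬝ᵥ Fnormal c = foffset c}
  face_supp : ∀ c, ∀ x ∈ Pbar, x ⬝ᵥ Fnormal c ≤ foffset c
  frontier_eq : frontier Pbar = ⋃ c, face c
  edge_def : ∀ b, edge b = segment ℝ (vert (esrc b)) (vert (etgt b))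
  edge_proper : ∀ b, esrc b ≠ etgt b
  edgeDir_unit : ∀ b, edgeDir b ⬝ᵥ edgeDir b = 1
  edgeDir_dir : ∀ b, ∃ lam : ℝ, 0 < lam ∧ vert (etgt b) - vert (esrc b) = lam • edgeDir b
  edge_two_faces : ∀ b, ∃ c c', edge b ⊆ face c ∧ edge b ⊆ face c' ∧
    crossProduct (Fnormal c) (Fnormal c') ≠ 0
  Cnormal_unit : ∀ a, Cnormal a ⬝ᵥ Cnormal a = 1
  sep_vert : ∀ a, 0 < (vert a - cpt a) ⬝ᵥ Cnormal a
  sep_other : ∀ a a', a' ≠ a → (vert a' - cpt a) ⬝ᵥ Cnormal a < 0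
  cleave_sub : ∀ a a' : Fin nv, ∀ x ∈ Pbar, (x - cpt a) ⬝ᵥ Cnormal a = 0 →
    (x - cpt a') ⬝ᵥ Cnormal a' ≤ 0
  m_ge : ∀ c, 3 ≤ m c
  fvert_per : ∀ c i, fvert c (i + m c) = fvert c i
  fedge_per : ∀ c i, fedge c (i + m c) = fedge c i
  fvert_inj : ∀ c, ∀ i j : ℕ, i < j → j < m c → fvert c i ≠ fvert c j
  fedge_seg : ∀ c i, edge (fedge c i) = segment ℝ (vert (fvert c i)) (vert (fvert c (i + 1)))
  fedge_sub : ∀ c i, edge (fedge c i) ⊆ face c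
  vm_ge : ∀ a, 3 ≤ vm a
  vedge_per : ∀ a i, vedge a (i + vm a) = vedge a i
  vface_per : ∀ a i, vface a (i + vm a) = vface a i
  vedge_inj : ∀ a, ∀ i j : ℕ, i < j → j < vm a → vedge a i ≠ vedge a j
  vedge_mem : ∀ a i, vert a ∈ edge (vedge a i)
  vface_between : ∀ a i, edge (vedge a i) ⊆ face (vface a i) ∧
    edge (vedge a (i + 1)) ⊆ face (vface a i)

namespace PolyCtx

variable (P : PolyCtx)

/-- `P`: the polyhedron `P̄` with its vertices removed. -/
def Pset : Set V3 := P.Pbar \ Set.range P.vert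

/-- The closed half-space `R^a` cut off by the cleaving plane at the vertex `a`. -/
def Rhalf (a : Fin P.nv) : Set V3 := {x | (x - P.cpt a) ⬝ᵥ P.Cnormal a ≤ 0}

/-- The intersection of all the half-spaces `R^a`. -/
def Rall : Set V3 := ⋂ a, P.Rhalf a

/-- The truncated polyhedron `P̂ = P ∩ ⋂ₐ R^a`. -/
def PhatSet : Set V3 := P.Pset ∩ P.Rall

/-- The cleaved face `Ĉ^a = C^a ∩ P`. -/
def Chat (a : Fin P.nv) : Set V3 := {x | (x - P.cpt a) ⬝ᵥ P.Cnormal a = 0} ∩ P.Pset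

/-- The truncated face `F̂^c = F^c ∩ ⋂ₐ R^a`. -/
def Fhat (c : Fin P.nf) : Set V3 := P.face c ∩ P.Rall

/-- The cleaved edge `B̂^{ac} = Ĉ^a ∩ F̂^c`. -/
def Bhat (a : Fin P.nv) (c : Fin P.nf) : Set V3 := P.Chat a ∩ P.Fhat c

/-- The truncated edge `Ê^b = E^b ∩ ⋂ₐ R^a`. -/
def Ehat (b : Fin P.ne) : Set V3 := P.edge b ∩ P.Rall

/-- The boundary `∂Ĉ^a` of the cleaved face: the union of its cleaved edges. -/
def bdChat (a : Fin P.nv) : Set V3 := ⋃ c, P.Bhat a c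

/-- The boundary `∂F̂^c` of the truncated face: its truncated edges and cleaved edges. -/
def bdFhat (c : Fin P.nf) : Set V3 :=
  (⋃ i ∈ Finset.range (P.m c), P.Ehat (P.fedge c i)) ∪
    ⋃ i ∈ Finset.range (P.m c), P.Bhat (P.fvert c i) c

/-- The boundary `∂P̂` of the truncated polyhedron: cleaved faces and truncated faces. -/
def bdPhat : Set V3 := (⋃ a, P.Chat a) ∪ ⋃ c, P.Fhat c

/-- `n ∈ C⁰(P)`: a continuous unit-vector field on `P`, tangent to each face. -/
def MemC0P (n : V3 → V3) : Prop :=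
  ContinuousOn n P.Pset ∧ (∀ x ∈ P.Pset, n x ∈ sphereS) ∧
  ∀ c, ∀ x ∈ P.face c ∩ P.Pset, n x ⬝ᵥ P.Fnormal c = 0

/-- `n ∈ C⁰(P̂)`: a continuous unit-vector field on `P̂`, tangent to each truncated
face `F̂^c` (but not necessarily to the cleaved faces). -/
def MemC0Phat (n : V3 → V3) : Prop :=
  ContinuousOn n P.PhatSet ∧ (∀ x ∈ P.PhatSet, n x ∈ sphereS) ∧
  ∀ c, ∀ x ∈ P.Fhat c, n x ⬝ᵥ P.Fnormal c = 0

/-- Homotopy in `C⁰(P)`. -/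
def HomotopicP (n n' : V3 → V3) : Prop :=
  ∃ H : ℝ → V3 → V3,
    ContinuousOn (fun q : ℝ × V3 => H q.1 q.2) (Set.Icc (0:ℝ) 1 ×ˢ P.Pset) ∧
    (∀ t ∈ Set.Icc (0:ℝ) 1, P.MemC0P (H t)) ∧
    (∀ x ∈ P.Pset, H 0 x = n x) ∧ (∀ x ∈ P.Pset, H 1 x = n' x)

/-- Homotopy in `C⁰(P̂)`. -/
def HomotopicPhat (n n' : V3 → V3) : Prop :=
  ∃ H : ℝ → V3 → V3,
    ContinuousOn (fun q : ℝ × V3 => H q.1 q.2) (Set.Icc (0:ℝ) 1 ×ˢ P.PhatSet) ∧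
    (∀ t ∈ Set.Icc (0:ℝ) 1, P.MemC0Phat (H t)) ∧
    (∀ x ∈ P.PhatSet, H 0 x = n x) ∧ (∀ x ∈ P.PhatSet, H 1 x = n' x)

/-- The edge orientation `e^b(n) = ε`: `n` has the constant value `ε` on `Ê^b`. -/
def IsEdgeOrient (b : Fin P.ne) (n : V3 → V3) (ε : V3) : Prop :=
  ∀ x ∈ P.Ehat b, n x = ε

/-- `z : [0,1] → ℝ³` is a continuous injective parameterization of the cleaved edge
`B̂^{ac}`, positively oriented with respect to the outward normal `F^c` (the face
`F̂^c` lies on the positive side of `F^c × (z 1 - z 0)`). -/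
def IsPosParamSeg (a : Fin P.nv) (c : Fin P.nf) (z : ℝ → V3) : Prop :=
  ContinuousOn z (Set.Icc 0 1) ∧ z '' Set.Icc 0 1 = P.Bhat a c ∧
  Set.InjOn z (Set.Icc 0 1) ∧
  ∀ x ∈ P.Fhat c, 0 ≤ (x - z 0) ⬝ᵥ crossProduct (P.Fnormal c) (z 1 - z 0)

/-- The kink number `k^{ac}(n) = κ`. -/
def HasKink (a : Fin P.nv) (c : Fin P.nf) (n : V3 → V3) (κ : ℤ) : Prop :=
  ∃ z : ℝ → V3, P.IsPosParamSeg a c z ∧ IsKinkAlong (P.Fnormal c) n z κ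

/-- `s ∈ S²` is admissible: not orthogonal to any face normal. -/
def AdmissibleS (s : V3) : Prop := s ∈ sphereS ∧ ∀ c, s ⬝ᵥ P.Fnormal c ≠ 0

/-- The wrapping number `w^a(n) = w`, computed (relative to a Brouwer degree `deg` and
an admissible reference point `s`) as the degree of the map `S² → S²` glued from the
restriction of `n` to the cleaved face `Ĉ^a` and the geodesic contraction of its boundary
values to `-s`, using an interior point `ctr` of `Ĉ^a` and a positively oriented
`2π`-periodic parameterization `z` of `∂Ĉ^a`. -/
def HasWrap (deg : (V3 → V3) → ℤ) (s : V3) (a : Fin P.nv) (n : V3 → V3) (w : ℤ) : Prop :=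
  ∃ ctr z, ctr ∈ P.Chat a ∧ ctr ∉ P.bdChat a ∧
    PosLoopParam (P.Cnormal a) ctr z ∧ Set.range z = P.bdChat a ∧
    deg (wrapMap n z ctr s) = w

/-- `n` and `n'` have the same invariants: equal edge orientations, kink numbers and
wrapping numbers. -/
def SameInv (deg : (V3 → V3) → ℤ) (s : V3) (n n' : V3 → V3) : Prop :=
  (∀ b : Fin P.ne, Set.EqOn n n' (P.Ehat b)) ∧
  (∀ a c, ∀ κ : ℤ, P.HasKink a c n κ ↔ P.HasKink a c n' κ) ∧
  (∀ a, ∀ w : ℤ, P.HasWrap deg s a n w ↔ P.HasWrap deg s a n' w)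

end PolyCtx

theorem perp_aux (u N N' : V3) (h1 : u ⬝ᵥ N = 0) (h2 : u ⬝ᵥ N' = 0)
    (h3 : u ⬝ᵥ crossProduct N N' = 0) (hu : u ⬝ᵥ u = 1) : crossProduct N N' = 0 := by
  have key : crossProduct N N' ⬝ᵥ crossProduct N N' = 0 := by
    have e : (u ⬝ᵥ u) * (crossProduct N N' ⬝ᵥ crossProduct N N') =
        (u ⬝ᵥ crossProduct N N') ^ 2 + ((u ⬝ᵥ N') • N - (u ⬝ᵥ N) • N') ⬝ᵥ
          ((u ⬝ᵥ N') • N - (u ⬝ᵥ N) • N') := by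
      simp [crossProduct, dotProduct, Fin.sum_univ_three]
      ring
    rw [h1, h2, h3, hu] at e
    simpa using e
  exact dotProduct_self_eq_zero.mp key

theorem mid_mem (P : PolyCtx) (b : Fin P.ne) :
    ∃ x ∈ P.edge b, x ∈ P.Pset := by
  refine ⟨(1/2 : ℝ) • P.vert (P.esrc b) + (1/2 : ℝ) • P.vert (P.etgt b), ?_, ?_, ?_⟩
  · rw [P.edge_def]
    exact ⟨1/2, 1/2, by norm_num, by norm_num, by norm_num, rfl⟩
  · rw [P.hull]
    exact (convex_convexHull ℝ _) (subset_convexHull ℝ _ (Set.mem_range_self _))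
      (subset_convexHull ℝ _ (Set.mem_range_self _)) (by norm_num) (by norm_num) (by norm_num)
  · rintro ⟨a, ha⟩
    have hs := P.sep_vert a
    have hne := P.edge_proper b
    have e : (P.vert a - P.cpt a) ⬝ᵥ P.Cnormal a =
        (1/2) * ((P.vert (P.esrc b) - P.cpt a) ⬝ᵥ P.Cnormal a) +
        (1/2) * ((P.vert (P.etgt b) - P.cpt a) ⬝ᵥ P.Cnormal a) := by
      rw [ha]
      simp [dotProduct, Fin.sum_univ_three]
      ring
    by_cases h1 : P.esrc b = a
    · have := P.sep_other a (P.etgt b) (fun h => hne (h1.trans h.symm))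
      rw [h1] at e
      linarith
    · have := P.sep_other a (P.esrc b) h1
      by_cases h2 : P.etgt b = a
      · rw [h2] at e
        linarith
      · have := P.sep_other a (P.etgt b) h2
        linarith

/-- For `n ∈ C⁰(P)`, the antipodal field `-n` has opposite edge
orientations, and `n` and `-n` are not homotopic in `C⁰(P)`. -/
theorem stmt_9 (P : PolyCtx) (n : V3 → V3) (hn : P.MemC0P n) :
    (∀ b : Fin P.ne, ∀ ε : V3, P.IsEdgeOrient b n ε →
      P.IsEdgeOrient b (fun x => -n x) (-ε)) ∧
    ¬ P.HomotopicP n (fun x => -n x) := by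
  refine ⟨fun b ε h x hx => by rw [← h x hx], ?_⟩
  rintro ⟨H, hc, hm, h0, h1⟩
  have hv : (Set.range P.vert).Nonempty := by
    obtain ⟨y, hy⟩ := P.int_nonempty
    have := interior_subset hy
    rw [P.hull] at this
    exact convexHull_nonempty_iff.mp ⟨y, this⟩
  obtain ⟨_, a, _⟩ := hv
  obtain ⟨x, hxe, hxP⟩ := mid_mem P (P.vedge a 0)
  obtain ⟨c, c', hcf, hcf', hcr⟩ := P.edge_two_faces (P.vedge a 0)
  set w := crossProduct (P.Fnormal c) (P.Fnormal c') with hw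
  have hne : ∀ t ∈ Set.Icc (0:ℝ) 1, H t x ⬝ᵥ w ≠ 0 := by
    intro t ht hz
    obtain ⟨-, hs, hT⟩ := hm t ht
    exact hcr (perp_aux (H t x) _ _ (hT c x ⟨hcf hxe, hxP⟩) (hT c' x ⟨hcf' hxe, hxP⟩) hz
      (hs x hxP))
  have hH : ContinuousOn (fun t => H t x) (Set.Icc (0:ℝ) 1) :=
    hc.comp (f := fun t : ℝ => (t, x)) (by fun_prop) (fun t ht => ⟨ht, hxP⟩)
  have hd : Continuous (fun v : V3 => v ⬝ᵥ w) := by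
    simp only [dotProduct]; fun_prop
  have hf : ContinuousOn (fun t => H t x ⬝ᵥ w) (Set.Icc (0:ℝ) 1) := hd.comp_continuousOn hH
  have e : H 1 x ⬝ᵥ w = - (H 0 x ⬝ᵥ w) := by
    rw [h0 x hxP, h1 x hxP, neg_dotProduct]
  have hfu : ContinuousOn (fun t => H t x ⬝ᵥ w) (Set.uIcc (0:ℝ) 1) := by
    rwa [Set.uIcc_of_le zero_le_one]
  have hz : (0:ℝ) ∈ Set.uIcc (H 0 x ⬝ᵥ w) (H 1 x ⬝ᵥ w) := by
    rw [e, Set.mem_uIcc]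
    rcases le_total (H 0 x ⬝ᵥ w) 0 with h | h
    · left; constructor <;> linarith
    · right; constructor <;> linarith
  obtain ⟨t, ht, hzt⟩ := intermediate_value_uIcc hfu hz
  rw [Set.uIcc_of_le zero_le_one] at ht
  exact hne t ht hzt
end
end

section
/- Let n̂ ∈ C⁰(P̂) be continuously differentiable on P̂ and suppose s is a regular value of the restriction of n̂ to the cleaved face Ĉ^a (i.e. the derivative dn̂ restricted to Ĉ^a has full rank at every preimage of s). Then the preimage n̂⁻¹(s) ∩ Ĉ^a is a finite set, and the wrapping number satisfies w^a(n̂) = ∑_{y ∈ n̂⁻¹(s) ∩ Ĉ^a} sgn det dn̂(y), where the determinant is computed with respect to positively oriented coordinates on Ĉ^a and on S². -/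
open Matrix Set MeasureTheory
open scoped Classical

noncomputable section

section Helpers

open Filter Topology ComplexConjugate

lemma dot3 (u v : V3) : u ⬝ᵥ v = u 0 * v 0 + u 1 * v 1 + u 2 * v 2 := by
  simp [dotProduct, Fin.sum_univ_three]

lemma deg_of_hom {deg : (V3 → V3) → ℤ} (hdeg : DegreeTheory deg) {f g : V3 → V3}
    (h : SphHomotopic f g) : deg f = deg g := by
  have h' := h
  obtain ⟨H, hc, hm, h0, h1⟩ := h
  have hsec : ∀ t ∈ Set.Icc (0:ℝ) 1, ContinuousOn (H t) sphereS := by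
    intro t ht
    have : ContinuousOn (fun x : V3 => ((t, x) : ℝ × V3)) sphereS := by fun_prop
    exact hc.comp this (fun x hx => ⟨ht, hx⟩)
  have z0 : (0:ℝ) ∈ Set.Icc (0:ℝ) 1 := by simp
  have z1 : (1:ℝ) ∈ Set.Icc (0:ℝ) 1 := by simp
  refine hdeg.1 f g ((hsec 0 z0).congr fun x hx => (h0 x hx).symm) ?_
    ((hsec 1 z1).congr fun x hx => (h1 x hx).symm) ?_ h'
  · intro x hx; rw [← h0 x hx]; exact hm 0 z0 hx
  · intro x hx; rw [← h1 x hx]; exact hm 1 z1 hx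

/-- positively oriented orthonormal frame -/
structure Frame3 (a b s : V3) : Prop where
  aa : a ⬝ᵥ a = 1
  bb : b ⬝ᵥ b = 1
  ss : s ⬝ᵥ s = 1
  ab : a ⬝ᵥ b = 0
  as : a ⬝ᵥ s = 0
  bs : b ⬝ᵥ s = 0
  cr : crossProduct a b = s

/-- combination in the frame -/
def comb (a b s : V3) (x y z : ℝ) : V3 := x • a + y • b + z • s

lemma comb_apply (a b s : V3) (x y z : ℝ) (i : Fin 3) :
    comb a b s x y z i = x * a i + y * b i + z * s i := by simp [comb]

lemma comb_contOn {Z : Type*} [TopologicalSpace Z] {a b s : V3} {x y z : Z → ℝ} {S : Set Z}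
    (hx : ContinuousOn x S) (hy : ContinuousOn y S) (hz : ContinuousOn z S) :
    ContinuousOn (fun w => comb a b s (x w) (y w) (z w)) S := by
  rw [continuousOn_pi]
  intro i
  simp only [comb_apply]
  fun_prop

lemma Frame3.dot_a {a b s : V3} (F : Frame3 a b s) (x y z : ℝ) :
    comb a b s x y z ⬝ᵥ a = x := by
  have h1 := F.aa; have h2 := F.ab; have h3 := F.as
  simp only [dot3, comb_apply] at *
  linear_combination x * h1 + y * h2 + z * h3

lemma Frame3.dot_b {a b s : V3} (F : Frame3 a b s) (x y z : ℝ) :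
    comb a b s x y z ⬝ᵥ b = y := by
  have h1 := F.ab; have h2 := F.bb; have h3 := F.bs
  simp only [dot3, comb_apply] at *
  linear_combination x * h1 + y * h2 + z * h3

lemma Frame3.dot_s {a b s : V3} (F : Frame3 a b s) (x y z : ℝ) :
    comb a b s x y z ⬝ᵥ s = z := by
  have h1 := F.as; have h2 := F.bs; have h3 := F.ss
  simp only [dot3, comb_apply] at *
  linear_combination x * h1 + y * h2 + z * h3

lemma Frame3.dot_self {a b s : V3} (F : Frame3 a b s) (x y z : ℝ) :
    comb a b s x y z ⬝ᵥ comb a b s x y z = x ^ 2 + y ^ 2 + z ^ 2 := by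
  have h1 := F.aa; have h2 := F.bb; have h3 := F.ss
  have h4 := F.ab; have h5 := F.as; have h6 := F.bs
  simp only [dot3, comb_apply] at *
  linear_combination x ^ 2 * h1 + y ^ 2 * h2 + z ^ 2 * h3 + 2 * x * y * h4 + 2 * x * z * h5 +
    2 * y * z * h6

lemma Frame3.decomp {a b s : V3} (F : Frame3 a b s) (v : V3) :
    comb a b s (v ⬝ᵥ a) (v ⬝ᵥ b) (v ⬝ᵥ s) = v := by
  have hM : (Matrix.of ![a, b, s]) * (Matrix.of ![a, b, s])ᵀ = 1 := by
    have h1 := F.aa; have h2 := F.bb; have h3 := F.ss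
    have h4 := F.ab; have h5 := F.as; have h6 := F.bs
    ext i j
    rw [dot3] at *
    fin_cases i <;> fin_cases j <;>
      simp [Matrix.mul_apply, Fin.sum_univ_three] <;> linarith
  have hM' := mul_eq_one_comm.mp hM
  have e : ∀ i j, a i * a j + b i * b j + s i * s j = if i = j then 1 else 0 := by
    intro i j
    have := congrFun (congrFun hM' i) j
    simpa [Matrix.mul_apply, Fin.sum_univ_three, Matrix.one_apply] using this
  ext i
  rw [comb_apply]
  simp only [dot3]
  have e0 := e 0 i; have e1 := e 1 i; have e2 := e 2 i
  fin_cases i <;> simp at * <;> linear_combination v 0 * e0 + v 1 * e1 + v 2 * e2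

lemma Frame3.norm {a b s : V3} (F : Frame3 a b s) (v : V3) :
    v ⬝ᵥ v = (v ⬝ᵥ a) ^ 2 + (v ⬝ᵥ b) ^ 2 + (v ⬝ᵥ s) ^ 2 := by
  conv_lhs => rw [← F.decomp v]
  rw [F.dot_self]

/-- Hopf map in the frame. -/
def hopf (a b s : V3) (p q : ℂ) : V3 :=
  comb a b s (2 * (p * conj q).re / (Complex.normSq p + Complex.normSq q))
    (2 * (p * conj q).im / (Complex.normSq p + Complex.normSq q))
    ((Complex.normSq p - Complex.normSq q) / (Complex.normSq p + Complex.normSq q))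

lemma nsq_pos {p q : ℂ} (h : p ≠ 0 ∨ q ≠ 0) : 0 < Complex.normSq p + Complex.normSq q := by
  rcases h with h | h
  · have := Complex.normSq_pos.mpr h; have := Complex.normSq_nonneg q; linarith
  · have := Complex.normSq_pos.mpr h; have := Complex.normSq_nonneg p; linarith

lemma hopf_sphere {a b s : V3} (F : Frame3 a b s) {p q : ℂ} (h : p ≠ 0 ∨ q ≠ 0) :
    hopf a b s p q ∈ sphereS := by
  have h1 := nsq_pos h
  change hopf a b s p q ⬝ᵥ hopf a b s p q = 1
  simp only [hopf, F.dot_self]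
  field_simp
  simp [Complex.normSq_apply]
  ring

lemma hopf_zero {a b s : V3} {q : ℂ} (h : q ≠ 0) : hopf a b s 0 q = -s := by
  have h1 := Complex.normSq_pos.mpr h
  ext i
  simp [hopf, comb_apply, neg_div, div_self h1.ne']

lemma hopf_inf {a b s : V3} {p : ℂ} (h : p ≠ 0) : hopf a b s p 0 = s := by
  have h1 := Complex.normSq_pos.mpr h
  ext i
  simp [hopf, comb_apply, div_self h1.ne']

lemma hopf_eq_s {a b s : V3} (F : Frame3 a b s) {p q : ℂ} (h : p ≠ 0 ∨ q ≠ 0) :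
    hopf a b s p q = s ↔ q = 0 := by
  constructor
  · intro e
    have h1 := nsq_pos h
    have h2 : hopf a b s p q ⬝ᵥ s = 1 := by rw [e, F.ss]
    rw [hopf, F.dot_s, div_eq_one_iff_eq h1.ne'] at h2
    have : Complex.normSq q = 0 := by linarith
    exact Complex.normSq_eq_zero.mp this
  · rintro rfl
    exact hopf_inf (by simpa using h)

lemma hopf_contOn {Z : Type*} [TopologicalSpace Z] {a b s : V3} {p q : Z → ℂ} {S : Set Z}
    (hp : ContinuousOn p S) (hq : ContinuousOn q S) (hne : ∀ z ∈ S, p z ≠ 0 ∨ q z ≠ 0) :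
    ContinuousOn (fun z => hopf a b s (p z) (q z)) S := by
  have h1 : ContinuousOn (fun z => Complex.normSq (p z)) S :=
    Complex.continuous_normSq.comp_continuousOn hp
  have h2 : ContinuousOn (fun z => Complex.normSq (q z)) S :=
    Complex.continuous_normSq.comp_continuousOn hq
  have h3 : ContinuousOn (fun z => p z * conj (q z)) S :=
    hp.mul (Complex.continuous_conj.comp_continuousOn hq)
  have h4 := Complex.continuous_re.comp_continuousOn h3
  have h5 := Complex.continuous_im.comp_continuousOn h3
  have h6 : ∀ z ∈ S, Complex.normSq (p z) + Complex.normSq (q z) ≠ 0 :=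
    fun z hz => (nsq_pos (hne z hz)).ne'
  unfold hopf
  apply comb_contOn
  · exact (continuousOn_const.mul h4).div (h1.add h2) h6
  · exact (continuousOn_const.mul h5).div (h1.add h2) h6
  · exact (h1.sub h2).div (h1.add h2) h6

lemma hopf_scale {a b s : V3} {p q : ℂ} {l : ℝ} (hl : l ≠ 0) :
    hopf a b s (l * p) (l * q) = hopf a b s p q := by
  have e : ∀ u v : ℝ, (l ^ 2 * u) / (l ^ 2 * v) = u / v := by
    intro u v; exact mul_div_mul_left u v (pow_ne_zero 2 hl)
  unfold hopf
  symm
  congr 1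
  · rw [← e]; congr 1 <;> simp [Complex.normSq_apply] <;> ring
  · rw [← e]; congr 1 <;> simp [Complex.normSq_apply] <;> ring
  · rw [← e]; congr 1 <;> simp [Complex.normSq_apply] <;> ring

/-- the perpendicular part -/
def perp (a b : V3) (v : V3) : ℂ := ⟨v ⬝ᵥ a, v ⬝ᵥ b⟩

lemma dot_cont (a : V3) : Continuous (fun v : V3 => v ⬝ᵥ a) := by
  simp only [dot3]; fun_prop

lemma perp_cont (a b : V3) : Continuous (perp a b) := by
  have : perp a b = fun v => ((v ⬝ᵥ a : ℝ) : ℂ) + ((v ⬝ᵥ b : ℝ) : ℂ) * Complex.I := by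
    ext v; simp [perp, Complex.ext_iff]
  rw [this]
  have h1 := dot_cont a
  have h2 := dot_cont b
  fun_prop

lemma perp_normSq {a b s : V3} (F : Frame3 a b s) {v : V3} (hv : v ∈ sphereS) :
    Complex.normSq (perp a b v) = (1 - v ⬝ᵥ s) * (2 - (1 - v ⬝ᵥ s)) := by
  have h := F.norm v
  have hv' : v ⬝ᵥ v = 1 := hv
  simp only [perp, Complex.normSq_apply]
  linarith

lemma sphere_d {a b s : V3} (F : Frame3 a b s) {v : V3} (hv : v ∈ sphereS) :
    0 ≤ 1 - v ⬝ᵥ s ∧ 1 - v ⬝ᵥ s ≤ 2 := by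
  have h := F.norm v
  have hv' : v ⬝ᵥ v = 1 := hv
  constructor <;> nlinarith [sq_nonneg (v ⬝ᵥ a), sq_nonneg (v ⬝ᵥ b)]

lemma sphere_eq_s {s v : V3} (hs : s ⬝ᵥ s = 1) (hv : v ∈ sphereS)
    (h : 1 - v ⬝ᵥ s = 0) : v = s := by
  have hv' : v ⬝ᵥ v = 1 := hv
  simp only [dot3] at *
  have h3 : (v 0 - s 0) ^ 2 + (v 1 - s 1) ^ 2 + (v 2 - s 2) ^ 2 = 0 := by linarith
  have a0 : v 0 - s 0 = 0 := by
    nlinarith [sq_nonneg (v 0 - s 0), sq_nonneg (v 1 - s 1), sq_nonneg (v 2 - s 2)]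
  have a1 : v 1 - s 1 = 0 := by
    nlinarith [sq_nonneg (v 0 - s 0), sq_nonneg (v 1 - s 1), sq_nonneg (v 2 - s 2)]
  have a2 : v 2 - s 2 = 0 := by
    nlinarith [sq_nonneg (v 0 - s 0), sq_nonneg (v 1 - s 1), sq_nonneg (v 2 - s 2)]
  ext i; fin_cases i <;> simp <;> linarith

lemma hopf_perp {a b s : V3} (F : Frame3 a b s) {v : V3} (hv : v ∈ sphereS) (hne : v ≠ s) :
    hopf a b s (perp a b v) ((1 - v ⬝ᵥ s : ℝ) : ℂ) = v := by
  have hd : 1 - v ⬝ᵥ s ≠ 0 := fun h => hne (sphere_eq_s F.ss hv h)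
  have h1 := perp_normSq F hv
  have hden : Complex.normSq (perp a b v) + Complex.normSq ((1 - v ⬝ᵥ s : ℝ) : ℂ)
      = 2 * (1 - v ⬝ᵥ s) := by
    rw [h1, Complex.normSq_ofReal]; ring
  unfold hopf
  rw [hden, h1, Complex.normSq_ofReal]
  conv_rhs => rw [← F.decomp v]
  congr 1
  · rw [Complex.conj_ofReal, Complex.re_mul_ofReal]
    rw [div_eq_iff (by simpa using hd)]; simp [perp]; ring
  · rw [Complex.conj_ofReal, Complex.im_mul_ofReal]
    rw [div_eq_iff (by simpa using hd)]; simp [perp]; ring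
  · rw [div_eq_iff (by simpa using hd)]; ring

lemma tendsto_s {Z : Type*} {l : Filter Z} {G : Z → V3} {s : V3} (hs : s ⬝ᵥ s = 1)
    (hG : ∀ᶠ z in l, G z ∈ sphereS) {B : Z → ℝ} (hB : ∀ᶠ z in l, 1 - G z ⬝ᵥ s ≤ B z)
    (hB0 : Tendsto B l (𝓝 0)) : Tendsto G l (𝓝 s) := by
  rw [tendsto_pi_nhds]
  intro i
  rw [tendsto_iff_dist_tendsto_zero]
  have hlim : Tendsto (fun z => Real.sqrt (2 * B z)) l (𝓝 0) := by
    have : Tendsto (fun z => Real.sqrt (2 * B z)) l (𝓝 (Real.sqrt (2 * 0))) :=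
      (Real.continuous_sqrt.tendsto _).comp (hB0.const_mul 2)
    simpa using this
  refine squeeze_zero' (Eventually.of_forall fun z => dist_nonneg) ?_ hlim
  filter_upwards [hG, hB] with z hz hb
  rw [Real.dist_eq]
  apply Real.abs_le_sqrt
  have hz' : G z ⬝ᵥ G z = 1 := hz
  simp only [dot3] at *
  fin_cases i <;> simp <;>
  nlinarith [sq_nonneg (G z 0 - s 0), sq_nonneg (G z 1 - s 1), sq_nonneg (G z 2 - s 2)]

lemma interp_bound {F F' : ℂ} {d d' t : ℝ} (hd : 0 < d) (hd1 : d ≤ 1) (hd' : 0 < d')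
    (hd1' : d' ≤ 1) (hF : Complex.normSq F = d * (2 - d)) (hF' : Complex.normSq F' = d' * (2 - d'))
    (ht : t ∈ Set.Icc (0:ℝ) 1) (hin : 0 ≤ (F * conj F').re) :
    (d * d') ^ 2 ≤ (4 * (d + d')) *
      Complex.normSq (((1 - t) * d' : ℝ) * F + (t * d : ℝ) * F') := by
  have hexp : Complex.normSq (((1 - t) * d' : ℝ) * F + (t * d : ℝ) * F') =
      ((1 - t) * d') ^ 2 * Complex.normSq F + (t * d) ^ 2 * Complex.normSq F' +
      2 * ((1 - t) * d' * (t * d)) * (F * conj F').re := by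
    simp [Complex.normSq_apply]; ring
  have h0 := ht.1
  have h1 := ht.2
  have hX : d * d' * ((1 - t) ^ 2 * d' + t ^ 2 * d) ≤
      Complex.normSq (((1 - t) * d' : ℝ) * F + (t * d : ℝ) * F') := by
    rw [hexp, hF, hF']
    have : 0 ≤ 2 * ((1 - t) * d' * (t * d)) * (F * conj F').re := by
      have : 0 ≤ 1 - t := by linarith
      positivity
    have e1 : 0 ≤ (1 - t) ^ 2 * d' ^ 2 * d * (1 - d) := by
      have : 0 ≤ 1 - d := by linarith
      positivity
    have e2 : 0 ≤ t ^ 2 * d ^ 2 * d' * (1 - d') := by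
      have : 0 ≤ 1 - d' := by linarith
      positivity
    nlinarith
  have hk : d * d' ≤ 4 * (d + d') * ((1 - t) ^ 2 * d' + t ^ 2 * d) := by
    have hq : 1 ≤ 4 * ((1 - t) ^ 2 + t ^ 2) := by nlinarith [sq_nonneg (1 - 2 * t)]
    have e1 : 0 ≤ (1 - t) ^ 2 * d' ^ 2 := by positivity
    have e2 : 0 ≤ t ^ 2 * d ^ 2 := by positivity
    have e3 : d * d' * 1 ≤ d * d' * (4 * ((1 - t) ^ 2 + t ^ 2)) :=
      mul_le_mul_of_nonneg_left hq (by positivity)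
    nlinarith
  calc (d * d') ^ 2 = (d * d') * (d * d') := by ring
    _ ≤ (d * d') * (4 * (d + d') * ((1 - t) ^ 2 * d' + t ^ 2 * d)) :=
      mul_le_mul_of_nonneg_left hk (by positivity)
    _ = (4 * (d + d')) * (d * d' * ((1 - t) ^ 2 * d' + t ^ 2 * d)) := by ring
    _ ≤ _ := mul_le_mul_of_nonneg_left hX (by positivity)

lemma interp {a b s : V3} (F : Frame3 a b s) {f f' : V3 → V3}
    (hf : ContinuousOn f sphereS) (hf' : ContinuousOn f' sphereS)
    (hm : MapsTo f sphereS sphereS) (hm' : MapsTo f' sphereS sphereS)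
    (hY : ∀ x ∈ sphereS, f x = s ↔ f' x = s)
    (hloc : ∀ y ∈ sphereS, f y = s → ∀ᶠ x in 𝓝[sphereS] y,
      0 ≤ (perp a b (f x) * conj (perp a b (f' x))).re) :
    SphHomotopic f f' := by
  set d : V3 → ℝ := fun x => 1 - f x ⬝ᵥ s with hdd
  set d' : V3 → ℝ := fun x => 1 - f' x ⬝ᵥ s with hdd'
  have hd0 : ∀ x ∈ sphereS, f x ≠ s → 0 < d x ∧ 0 < d' x := by
    intro x hx hne
    refine ⟨lt_of_le_of_ne (sphere_d F (hm hx)).1 fun h => hne (sphere_eq_s F.ss (hm hx) h.symm),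
      lt_of_le_of_ne (sphere_d F (hm' hx)).1 fun h => hne ((hY x hx).mpr
        (sphere_eq_s F.ss (hm' hx) h.symm))⟩
  set X : ℝ × V3 → ℂ := fun q => ((1 - q.1) * d' q.2 : ℝ) * perp a b (f q.2) +
    (q.1 * d q.2 : ℝ) * perp a b (f' q.2) with hX
  set D : ℝ × V3 → ℂ := fun q => ((d q.2 * d' q.2 : ℝ) : ℂ) with hD
  have hDne : ∀ q : ℝ × V3, q.2 ∈ sphereS → f q.2 ≠ s → D q ≠ 0 := by
    intro q hq hne
    have := hd0 q.2 hq hne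
    simp only [hD]
    exact_mod_cast (mul_pos this.1 this.2).ne'
  have hdc : ContinuousOn d sphereS := continuousOn_const.sub ((dot_cont s).comp_continuousOn hf)
  have hdc' : ContinuousOn d' sphereS :=
    continuousOn_const.sub ((dot_cont s).comp_continuousOn hf')
  have hsnd : MapsTo (Prod.snd : ℝ × V3 → V3) (Icc (0:ℝ) 1 ×ˢ sphereS) sphereS :=
    fun q hq => hq.2
  have c1 : ContinuousOn (fun q : ℝ × V3 => d q.2) (Icc (0:ℝ) 1 ×ˢ sphereS) :=
    hdc.comp continuousOn_snd hsnd
  have c2 : ContinuousOn (fun q : ℝ × V3 => d' q.2) (Icc (0:ℝ) 1 ×ˢ sphereS) :=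
    hdc'.comp continuousOn_snd hsnd
  have c3 : ContinuousOn (fun q : ℝ × V3 => perp a b (f q.2)) (Icc (0:ℝ) 1 ×ˢ sphereS) :=
    (perp_cont a b).comp_continuousOn (hf.comp continuousOn_snd hsnd)
  have c4 : ContinuousOn (fun q : ℝ × V3 => perp a b (f' q.2)) (Icc (0:ℝ) 1 ×ˢ sphereS) :=
    (perp_cont a b).comp_continuousOn (hf'.comp continuousOn_snd hsnd)
  have hXc : ContinuousOn X (Icc (0:ℝ) 1 ×ˢ sphereS) := by
    refine ContinuousOn.add (ContinuousOn.mul ?_ c3) (ContinuousOn.mul ?_ c4)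
    · exact Complex.continuous_ofReal.comp_continuousOn
        ((continuousOn_const.sub continuousOn_fst).mul c2)
    · exact Complex.continuous_ofReal.comp_continuousOn (continuousOn_fst.mul c1)
  have hDc : ContinuousOn D (Icc (0:ℝ) 1 ×ˢ sphereS) :=
    Complex.continuous_ofReal.comp_continuousOn (c1.mul c2)
  have hHs : ∀ q : ℝ × V3, q ∈ (Icc (0:ℝ) 1 ×ˢ sphereS) →
      (if f q.2 = s then s else hopf a b s (X q) (D q)) ∈ sphereS := by
    intro q hq
    split_ifs with h
    · exact F.ss
    · exact hopf_sphere F (Or.inr (hDne q hq.2 h))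
  refine ⟨fun t x => if f x = s then s else hopf a b s (X (t, x)) (D (t, x)), ?_, ?_, ?_, ?_⟩
  · rintro ⟨t0, x0⟩ ⟨ht0, hx0⟩
    by_cases h0 : f x0 = s
    · have hval : (fun q : ℝ × V3 => if f q.2 = s then s else
        hopf a b s (X (q.1, q.2)) (D (q.1, q.2))) (t0, x0) = s := by simp [h0]
      unfold ContinuousWithinAt
      rw [hval]
      have hmem : ∀ᶠ q in 𝓝[Icc (0:ℝ) 1 ×ˢ sphereS] (t0, x0), q ∈ Icc (0:ℝ) 1 ×ˢ sphereS :=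
        self_mem_nhdsWithin
      have hlim : Tendsto (fun q : ℝ × V3 => 8 * (d q.2 + d' q.2))
          (𝓝[Icc (0:ℝ) 1 ×ˢ sphereS] (t0, x0)) (𝓝 0) := by
        have := ((c1.add c2) (t0, x0) ⟨ht0, hx0⟩).tendsto.const_mul 8
        have e1 : d x0 = 0 := by simp [hdd, h0, F.ss]
        have e2 : d' x0 = 0 := by simp [hdd', (hY x0 hx0).mp h0, F.ss]
        simpa [e1, e2] using this
      have hlt : ∀ᶠ q in 𝓝[Icc (0:ℝ) 1 ×ˢ sphereS] (t0, x0), 8 * (d q.2 + d' q.2) < 1 :=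
        hlim.eventually (gt_mem_nhds (by norm_num))
      have hl2 : ∀ᶠ q in 𝓝[Icc (0:ℝ) 1 ×ˢ sphereS] (t0, x0),
          0 ≤ (perp a b (f q.2) * conj (perp a b (f' q.2))).re := by
        have : Tendsto (Prod.snd : ℝ × V3 → V3) (𝓝[Icc (0:ℝ) 1 ×ˢ sphereS] (t0, x0))
            (𝓝[sphereS] x0) :=
          continuousWithinAt_snd.tendsto_nhdsWithin hsnd
        exact this.eventually (hloc x0 hx0 h0)
      refine tendsto_s F.ss (hmem.mono fun q hq => hHs q hq) ?_ hlim
      filter_upwards [hmem, hlt, hl2] with q hq hl hi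
      have p1 := sphere_d F (hm hq.2)
      have p2 := sphere_d F (hm' hq.2)
      change 0 ≤ d q.2 ∧ d q.2 ≤ 2 at p1
      change 0 ≤ d' q.2 ∧ d' q.2 ≤ 2 at p2
      split_ifs with h
      · rw [F.ss]; linarith
      · have p3 := hd0 q.2 hq.2 h
        have hb := interp_bound p3.1 (by linarith) p3.2 (by linarith) (perp_normSq F (hm hq.2))
          (perp_normSq F (hm' hq.2)) hq.1 hi
        change (d q.2 * d' q.2) ^ 2 ≤ 4 * (d q.2 + d' q.2) * Complex.normSq (X q) at hb
        have hpos := nsq_pos (p := X q) (Or.inr (hDne q hq.2 h))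
        have hDs : Complex.normSq (D q) = (d q.2 * d' q.2) ^ 2 := by
          simp only [hD, Complex.normSq_ofReal]; ring
        rw [hopf, F.dot_s]
        rw [one_sub_div hpos.ne', div_le_iff₀ hpos]
        have hXn := Complex.normSq_nonneg (X q)
        have hDn := Complex.normSq_nonneg (D q)
        have : 0 ≤ 8 * (d q.2 + d' q.2) * Complex.normSq (D q) := by
          apply mul_nonneg _ hDn; linarith
        simp only [Prod.mk.eta]
        rw [hDs] at *
        nlinarith
    · have hopen : ∀ᶠ q in 𝓝[Icc (0:ℝ) 1 ×ˢ sphereS] (t0, x0), f q.2 ≠ s :=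
        ((hf.comp continuousOn_snd hsnd) (t0, x0) ⟨ht0, hx0⟩).eventually_ne h0
      have hc : ContinuousWithinAt (fun q : ℝ × V3 => hopf a b s (X q) (D q))
          (Icc (0:ℝ) 1 ×ˢ sphereS) (t0, x0) := by
        have hS : ContinuousOn (fun q : ℝ × V3 => hopf a b s (X q) (D q))
            (Icc (0:ℝ) 1 ×ˢ sphereS ∩ {q | f q.2 ≠ s}) :=
          hopf_contOn (hXc.mono inter_subset_left) (hDc.mono inter_subset_left)
            fun q hq => Or.inr (hDne q hq.1.2 hq.2)
        have h2 := hS (t0, x0) ⟨⟨ht0, hx0⟩, h0⟩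
        refine h2.mono_of_mem_nhdsWithin ?_
        exact inter_mem self_mem_nhdsWithin hopen
      refine hc.congr_of_eventuallyEq ?_ ?_
      · filter_upwards [hopen] with q hq
        simp [hq]
      · simp [h0]
  · intro t ht x hx
    exact hHs (t, x) ⟨ht, hx⟩
  · intro x hx
    by_cases h : f x = s
    · simp [h]
    · simp only [h, if_false, hX, hD]
      have p3 := hd0 x hx h
      have := hopf_scale (a := a) (b := b) (s := s) (p := perp a b (f x)) (q := (d x : ℝ))
        p3.2.ne'
      rw [hopf_perp F (hm hx) h] at this
      refine Eq.trans ?_ this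
      congr 1 <;> push_cast <;> ring
  · intro x hx
    by_cases h : f x = s
    · simp [h, (hY x hx).mp h]
    · simp only [h, if_false, hX, hD]
      have p3 := hd0 x hx h
      have h' : f' x ≠ s := fun e => h ((hY x hx).mpr e)
      have := hopf_scale (a := a) (b := b) (s := s) (p := perp a b (f' x)) (q := (d' x : ℝ))
        p3.1.ne'
      rw [hopf_perp F (hm' hx) h'] at this
      refine Eq.trans ?_ this
      congr 1 <;> push_cast <;> ring

lemma polar_cont {T Y : Type*} [TopologicalSpace T] [TopologicalSpace Y] {G : T → ℝ → ℝ → Y}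
    (hG : Continuous fun p : T × ℝ × ℝ => G p.1 p.2.1 p.2.2)
    (hper : ∀ t φ ρ, G t (φ + 2 * Real.pi) ρ = G t φ ρ)
    (h0 : ∀ t φ, G t φ 0 = G t 0 0) :
    Continuous fun p : T × ℂ => G p.1 (Complex.arg p.2) ‖p.2‖ := by
  rw [continuous_iff_continuousAt]
  rintro ⟨t0, ξ0⟩
  by_cases h : ξ0 = 0
  · subst h
    unfold ContinuousAt
    change Tendsto _ _ (𝓝 (G t0 (Complex.arg 0) ‖(0:ℂ)‖))
    rw [Complex.arg_zero, norm_zero, tendsto_def]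
    intro U hU
    have key : ∀ᶠ q in 𝓝 (t0, (0:ℝ)), ∀ φ ∈ Icc (-Real.pi) Real.pi, G q.1 φ q.2 ∈ U := by
      refine IsCompact.eventually_forall_of_forall_eventually isCompact_Icc ?_
      intro φ _
      have hc : Continuous fun z : (T × ℝ) × ℝ => G z.1.1 z.2 z.1.2 :=
        hG.comp (by fun_prop : Continuous fun z : (T × ℝ) × ℝ => (z.1.1, z.2, z.1.2))
      refine hc.continuousAt.eventually_mem ?_
      simpa [h0 t0 φ] using hU
    have hc2 : ContinuousAt (fun p : T × ℂ => (p.1, ‖p.2‖)) (t0, 0) := by fun_prop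
    have h3 : Tendsto (fun p : T × ℂ => (p.1, ‖p.2‖)) (𝓝 (t0, 0)) (𝓝 (t0, (0:ℝ))) := by
      simpa [ContinuousAt] using hc2
    filter_upwards [h3.eventually key] with p hp
    exact hp _ ⟨(Complex.neg_pi_lt_arg _).le, Complex.arg_le_pi _⟩
  · have hper' : ∀ t ρ, Function.Periodic (fun φ => G t φ ρ) (2 * Real.pi) :=
      fun t ρ φ => hper t φ ρ
    have harg : ∀ ξ : ℂ, ξ ≠ 0 → ∀ t ρ, G t (Complex.arg ξ) ρ =
        G t (Complex.arg ξ0 + Complex.arg (ξ / ξ0)) ρ := by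
      intro ξ hξ t ρ
      have h1 := Complex.arg_mul_coe_angle h (div_ne_zero hξ h)
      rw [mul_div_cancel₀ _ h] at h1
      rw [← Real.Angle.coe_add, Real.Angle.angle_eq_iff_two_pi_dvd_sub] at h1
      obtain ⟨k, hk⟩ := h1
      have := (hper' t ρ).int_mul k (Complex.arg ξ0 + Complex.arg (ξ / ξ0))
      rw [← this]
      congr 1
      linarith
    have hc : ContinuousAt (fun p : T × ℂ =>
        G p.1 (Complex.arg ξ0 + Complex.arg (p.2 / ξ0)) ‖p.2‖) (t0, ξ0) := by
      have h1 : ContinuousAt (fun p : T × ℂ => Complex.arg (p.2 / ξ0)) (t0, ξ0) := by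
        have h2 : ContinuousAt Complex.arg (((t0, ξ0) : T × ℂ).2 / ξ0) := by
          apply Complex.continuousAt_arg; simp [div_self h]
        exact ContinuousAt.comp (f := fun p : T × ℂ => p.2 / ξ0) h2 (by fun_prop)
      have h3 : ContinuousAt (fun p : T × ℂ =>
          (p.1, Complex.arg ξ0 + Complex.arg (p.2 / ξ0), ‖p.2‖)) (t0, ξ0) := by fun_prop
      exact ContinuousAt.comp (f := fun p : T × ℂ =>
          (p.1, Complex.arg ξ0 + Complex.arg (p.2 / ξ0), ‖p.2‖)) hG.continuousAt h3
    refine hc.congr ?_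
    have : ∀ᶠ p : T × ℂ in 𝓝 (t0, ξ0), p.2 ≠ 0 :=
      continuousAt_snd.eventually_ne h
    filter_upwards [this] with p hp
    exact (harg p.2 hp _ _).symm

lemma polar_cont' {Y : Type*} [TopologicalSpace Y] {G : ℝ → ℝ → Y}
    (hG : Continuous fun p : ℝ × ℝ => G p.1 p.2)
    (hper : ∀ φ ρ, G (φ + 2 * Real.pi) ρ = G φ ρ)
    (h0 : ∀ φ, G φ 0 = G 0 0) :
    Continuous fun ξ : ℂ => G (Complex.arg ξ) ‖ξ‖ := by
  have := polar_cont (T := Unit) (G := fun _ φ ρ => G φ ρ) (hG.comp continuous_snd)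
    (fun _ => hper) (fun _ => h0)
  exact this.comp (by fun_prop : Continuous fun ξ : ℂ => ((), ξ))

def xi (x : V3) : ℂ := (x 0 : ℂ) + (x 1 : ℂ) * Complex.I

lemma xi_cont : Continuous xi := by unfold xi; fun_prop

lemma xi_norm (x : V3) : ‖xi x‖ = Real.sqrt (x 0 ^ 2 + x 1 ^ 2) := by
  rw [xi, Complex.norm_add_mul_I]

lemma xi_norm_sq {x : V3} (hx : x ∈ sphereS) : ‖xi x‖ ^ 2 = 1 - x 2 ^ 2 := by
  have hx' : x ⬝ᵥ x = 1 := hx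
  rw [dot3] at hx'
  rw [xi_norm, Real.sq_sqrt (by positivity)]
  linarith

lemma sph_x2 {x : V3} (hx : x ∈ sphereS) : -1 ≤ x 2 ∧ x 2 ≤ 1 := by
  have := xi_norm_sq hx
  constructor <;> nlinarith [sq_nonneg ‖xi x‖]

def kap (x : V3) : ℝ := (1 - (min (x 2) 0) ^ 2)⁻¹

lemma kap_den {x : V3} (h : -1 < x 2) : 0 < 1 - (min (x 2) 0) ^ 2 := by
  rcases le_total (x 2) 0 with h0 | h0
  · rw [min_eq_left h0]; nlinarith
  · rw [min_eq_right h0]; norm_num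

lemma kap_pos {x : V3} (h : -1 < x 2) : 0 < kap x := inv_pos.mpr (kap_den h)

lemma kap_up {x : V3} (h : 0 ≤ x 2) : kap x = 1 := by simp [kap, min_eq_right h]

lemma kap_low {x : V3} (hx : x ∈ sphereS) (h : -1 < x 2) (h0 : x 2 ≤ 0) : 1 ≤ kap x * ‖xi x‖ := by
  have h1 := xi_norm_sq hx
  have h2 : kap x = (‖xi x‖ ^ 2)⁻¹ := by rw [kap, min_eq_left h0, h1]
  have h3 : 0 < ‖xi x‖ ^ 2 := by rw [h1]; nlinarith
  have h4 : 0 < ‖xi x‖ := by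
    rcases (norm_nonneg (xi x)).lt_or_eq with h | h
    · exact h
    · rw [← h] at h3; norm_num at h3
  have h5 : ‖xi x‖ ≤ 1 := by nlinarith [sq_nonneg (x 2)]
  rw [h2, pow_two, mul_inv, mul_assoc, inv_mul_cancel₀ h4.ne', mul_one]
  exact (one_le_inv₀ h4).mpr h5

lemma kap_contOn : ContinuousOn kap {x | -1 < x 2} := by
  unfold kap
  refine ContinuousOn.inv₀ (by fun_prop) ?_
  intro x hx
  exact (kap_den hx).ne'

def chi (x : V3) : ℝ := max 0 (min 1 (1 + 2 * x 2))

lemma chi_cont : Continuous chi := by unfold chi; fun_prop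

lemma chi_up {x : V3} (h : 0 ≤ x 2) : chi x = 1 := by
  unfold chi; rw [min_eq_left (by linarith)]; norm_num

lemma chi_low {x : V3} (h : x 2 ≤ -1/2) : chi x = 0 := by
  unfold chi; rw [max_eq_left]; exact (min_le_right _ _).trans (by linarith)

lemma chi_nonneg (x : V3) : 0 ≤ chi x := le_max_left _ _

def hopfMap (a b s : V3) (E Q : V3 → ℂ) : V3 → V3 := fun x =>
  if x 2 ≤ -1/2 then -s else hopf a b s (chi x * E x) (Q x)

lemma hopfMap_of {a b s : V3} {E Q : V3 → ℂ} {x : V3} (hQ : x 2 ≤ 0 → Q x ≠ 0) :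
    hopfMap a b s E Q x = hopf a b s (chi x * E x) (Q x) := by
  unfold hopfMap
  split_ifs with h
  · rw [chi_low h]; simp [hopf_zero (hQ (by linarith))]
  · rfl

lemma hopf_ne {E Q : V3 → ℂ} {x : V3} (hE : E x ≠ 0) (hQ : x 2 ≤ 0 → Q x ≠ 0) :
    (chi x : ℂ) * E x ≠ 0 ∨ Q x ≠ 0 := by
  rcases le_total (x 2) 0 with h | h
  · exact Or.inr (hQ h)
  · left; rw [chi_up h]; simpa using hE

lemma hopf_homotopy {a b s : V3} (F : Frame3 a b s) {E Q : ℝ → V3 → ℂ}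
    (hEc : ContinuousOn (fun p : ℝ × V3 => E p.1 p.2) (univ ×ˢ {x | -1 < x 2}))
    (hQc : ContinuousOn (fun p : ℝ × V3 => Q p.1 p.2) (univ ×ˢ {x | -1 < x 2}))
    (hE : ∀ t ∈ Icc (0:ℝ) 1, ∀ x ∈ sphereS, -1 < x 2 → E t x ≠ 0)
    (hQ : ∀ t ∈ Icc (0:ℝ) 1, ∀ x ∈ sphereS, -1 < x 2 → x 2 ≤ 0 → Q t x ≠ 0) :
    SphHomotopic (hopfMap a b s (E 0) (Q 0)) (hopfMap a b s (E 1) (Q 1)) := by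
  refine ⟨fun t => hopfMap a b s (E t) (Q t), ?_, ?_, fun _ _ => rfl, fun _ _ => rfl⟩
  · have hop1 : IsOpen {q : ℝ × V3 | -1 < q.2 2} :=
      isOpen_lt continuous_const (by fun_prop)
    have hop2 : IsOpen {q : ℝ × V3 | q.2 2 < -1/2} :=
      isOpen_lt (by fun_prop) continuous_const
    have main : ContinuousOn (fun q : ℝ × V3 => hopf a b s (chi q.2 * E q.1 q.2) (Q q.1 q.2))
        ((Icc (0:ℝ) 1 ×ˢ sphereS) ∩ {q : ℝ × V3 | -1 < q.2 2}) := by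
      have hsub : ((Icc (0:ℝ) 1 ×ˢ sphereS) ∩ {q : ℝ × V3 | -1 < q.2 2}) ⊆
          (univ ×ˢ {x : V3 | -1 < x 2}) := fun q hq => ⟨mem_univ _, hq.2⟩
      refine hopf_contOn ?_ (hQc.mono hsub) ?_
      · refine ContinuousOn.mul ?_ (hEc.mono hsub)
        exact (Complex.continuous_ofReal.comp (chi_cont.comp continuous_snd)).continuousOn
      · rintro ⟨t, x⟩ ⟨⟨ht, hx⟩, h1⟩
        exact hopf_ne (hE t ht x hx h1) (hQ t ht x hx h1)
    rintro ⟨t0, x0⟩ ⟨ht0, hx0⟩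
    by_cases h1 : -1 < x0 2
    · have h2 := main (t0, x0) ⟨⟨ht0, hx0⟩, h1⟩
      have h3 : ContinuousWithinAt
          (fun q : ℝ × V3 => hopf a b s (chi q.2 * E q.1 q.2) (Q q.1 q.2))
          (Icc (0:ℝ) 1 ×ˢ sphereS) (t0, x0) :=
        (continuousWithinAt_inter (hop1.mem_nhds h1)).mp h2
      refine h3.congr_of_eventuallyEq ?_ ?_
      · have : ∀ᶠ q in 𝓝[Icc (0:ℝ) 1 ×ˢ sphereS] (t0, x0), q ∈ {q : ℝ × V3 | -1 < q.2 2} :=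
          mem_nhdsWithin_of_mem_nhds (hop1.mem_nhds h1)
        filter_upwards [this, self_mem_nhdsWithin] with q hq1 hq2
        exact hopfMap_of (hQ q.1 hq2.1 q.2 hq2.2 hq1)
      · exact hopfMap_of (hQ t0 ht0 x0 hx0 h1)
    · have h2 : x0 2 < -1/2 := by linarith
      have h3 : ContinuousWithinAt (fun q : ℝ × V3 => -s) (Icc (0:ℝ) 1 ×ˢ sphereS) (t0, x0) :=
        continuousWithinAt_const
      refine h3.congr_of_eventuallyEq ?_ ?_
      · have : ∀ᶠ q in 𝓝[Icc (0:ℝ) 1 ×ˢ sphereS] (t0, x0), q ∈ {q : ℝ × V3 | q.2 2 < -1/2} :=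
          mem_nhdsWithin_of_mem_nhds (hop2.mem_nhds h2)
        filter_upwards [this] with q hq
        have : q.2 2 ≤ -1/2 := le_of_lt hq
        simp [hopfMap, this]
      · simp [hopfMap, h2.le]
  · intro t ht x hx
    change hopfMap a b s (E t) (Q t) x ∈ sphereS
    by_cases h1 : -1 < x 2
    · rw [hopfMap_of (hQ t ht x hx h1)]
      exact hopf_sphere F (hopf_ne (hE t ht x hx h1) (hQ t ht x hx h1))
    · have h2 : x 2 ≤ -1/2 := by linarith
      simp only [hopfMap, h2, if_true]
      have := F.ss
      change -s ⬝ᵥ -s = 1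
      simp only [dot3, Pi.neg_apply] at *
      linarith

lemma sphHom_left {f g : V3 → V3} (h : SphHomotopic f g) :
    ContinuousOn f sphereS ∧ MapsTo f sphereS sphereS := by
  obtain ⟨H, hc, hm, h0, h1⟩ := h
  have z0 : (0:ℝ) ∈ Set.Icc (0:ℝ) 1 := by simp
  constructor
  · have h2 : ContinuousOn (fun x : V3 => ((0, x) : ℝ × V3)) sphereS := by fun_prop
    have h3 : ContinuousOn (H 0) sphereS := hc.comp h2 (fun x hx => ⟨z0, hx⟩)
    exact h3.congr fun x hx => (h0 x hx).symm
  · intro x hx; rw [← h0 x hx]; exact hm 0 z0 hx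

lemma sphHom_right {f g : V3 → V3} (h : SphHomotopic f g) :
    ContinuousOn g sphereS ∧ MapsTo g sphereS sphereS := by
  obtain ⟨H, hc, hm, h0, h1⟩ := h
  have z0 : (1:ℝ) ∈ Set.Icc (0:ℝ) 1 := by simp
  constructor
  · have h2 : ContinuousOn (fun x : V3 => ((1, x) : ℝ × V3)) sphereS := by fun_prop
    have h3 : ContinuousOn (H 1) sphereS := hc.comp h2 (fun x hx => ⟨z0, hx⟩)
    exact h3.congr fun x hx => (h1 x hx).symm
  · intro x hx; rw [← h1 x hx]; exact hm 1 z0 hx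

/-- continuous planar power map -/
def pc (k : ℤ) (ξ : ℂ) : ℂ := (‖ξ‖ : ℂ) * Complex.exp (((k * Complex.arg ξ : ℝ) : ℂ) * Complex.I)

lemma pc_cont (k : ℤ) : Continuous (pc k) := by
  refine polar_cont' (G := fun φ ρ => (ρ : ℂ) * Complex.exp (((k * φ : ℝ) : ℂ) * Complex.I))
    (by fun_prop) ?_ ?_
  · intro φ ρ
    congr 1
    rw [show (((k * (φ + 2 * Real.pi) : ℝ) : ℂ) * Complex.I) =
      (((k * φ : ℝ) : ℂ) * Complex.I) + k * (2 * Real.pi * Complex.I) by push_cast; ring]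
    rw [Complex.exp_add, Complex.exp_int_mul_two_pi_mul_I, mul_one]
  · intro φ; simp

lemma pc_norm (k : ℤ) (ξ : ℂ) : Complex.normSq (pc k ξ) = ‖ξ‖ ^ 2 := by
  rw [Complex.normSq_eq_norm_sq, pc, norm_mul, Complex.norm_exp_ofReal_mul_I]; simp

lemma powMap_eq (k : ℤ) (x : V3) : powMap k x = ![(pc k (xi x)).re, (pc k (xi x)).im, x 2] := by
  unfold powMap
  change (if xi x = 0 then x else ![‖xi x‖ * ((xi x / (‖xi x‖ : ℂ)) ^ k).re,
    ‖xi x‖ * ((xi x / (‖xi x‖ : ℂ)) ^ k).im, x 2]) = _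
  split_ifs with h
  · have h1 : x 0 = 0 := by simpa [xi] using congrArg Complex.re h
    have h2 : x 1 = 0 := by simpa [xi] using congrArg Complex.im h
    ext i; fin_cases i <;> simp [pc, h, h1, h2]
  · have e : (xi x / (‖xi x‖ : ℂ)) ^ k =
        Complex.exp (((k * Complex.arg (xi x) : ℝ) : ℂ) * Complex.I) := by
      have hn : (‖xi x‖ : ℂ) ≠ 0 := by simpa using h
      have : xi x / (‖xi x‖ : ℂ) = Complex.exp (Complex.arg (xi x) * Complex.I) := by
        rw [div_eq_iff hn, mul_comm]; exact (Complex.norm_mul_exp_arg_mul_I _).symm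
      rw [this, ← Complex.exp_int_mul]; congr 1; push_cast; ring
    rw [e]
    ext i; fin_cases i <;> simp [pc]

def powF (a b s : V3) (k : ℤ) (x : V3) : V3 :=
  comb a b s (pc k (xi x)).re (pc k (xi x)).im (x 2)

lemma exists_frame {s : V3} (hs : s ∈ sphereS) : ∃ a b : V3, Frame3 a b s ∧
    ∀ k, SphHomotopic (powF a b s k) (powMap k) := by
  set α := Real.arccos (s 2)
  set β := Complex.arg (xi s)
  have hx2 := sph_x2 hs
  have hc : Real.cos α = s 2 := Real.cos_arccos hx2.1 hx2.2
  have hsn : Real.sin α = ‖xi s‖ := by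
    rw [Real.sin_arccos, ← xi_norm_sq hs, Real.sqrt_sq (norm_nonneg _)]
  have h0 : ‖xi s‖ * Real.cos β = s 0 := by
    rw [Complex.norm_mul_cos_arg]; simp [xi]
  have h1 : ‖xi s‖ * Real.sin β = s 1 := by
    rw [Complex.norm_mul_sin_arg]; simp [xi]
  let A : ℝ → V3 := fun t => ![Real.cos (t * α) * Real.cos (t * β),
    Real.cos (t * α) * Real.sin (t * β), -Real.sin (t * α)]
  let B : ℝ → V3 := fun t => ![-Real.sin (t * β), Real.cos (t * β), 0]
  let S : ℝ → V3 := fun t => ![Real.sin (t * α) * Real.cos (t * β),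
    Real.sin (t * α) * Real.sin (t * β), Real.cos (t * α)]
  have hF : ∀ t, Frame3 (A t) (B t) (S t) := by
    intro t
    have e1 := Real.sin_sq_add_cos_sq (t * α)
    have e2 := Real.sin_sq_add_cos_sq (t * β)
    set c := Real.cos (t * α)
    set d := Real.sin (t * α)
    set c' := Real.cos (t * β)
    set d' := Real.sin (t * β)
    have hA : A t = ![c * c', c * d', -d] := rfl
    have hB : B t = ![-d', c', 0] := rfl
    have hS : S t = ![d * c', d * d', c] := rfl
    rw [hA, hB, hS]
    constructor
    · simp; linear_combination c ^ 2 * e2 + e1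
    · simp; linear_combination e2
    · simp; linear_combination d ^ 2 * e2 + e1
    · simp; ring
    · simp; linear_combination c * d * e2
    · simp; ring
    · rw [cross_apply]
      ext i; fin_cases i
      · simp
      · simp
      · simp; linear_combination c * e2
  have hS1 : S 1 = s := by
    ext i; fin_cases i
    · simp [S, hsn, h0]
    · simp [S, hsn, h1]
    · simp [S, hc]
  refine ⟨A 1, B 1, hS1 ▸ hF 1, fun k => ?_⟩
  refine ⟨fun t x => comb (A (1 - t)) (B (1 - t)) (S (1 - t)) (pc k (xi x)).re (pc k (xi x)).im
    (x 2), ?_, ?_, ?_, ?_⟩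
  · apply Continuous.continuousOn
    have hp : Continuous fun q : ℝ × V3 => pc k (xi q.2) :=
      (pc_cont k).comp (xi_cont.comp continuous_snd)
    have hp1 := Complex.continuous_re.comp hp
    have hp2 := Complex.continuous_im.comp hp
    simp only [Function.comp_def] at hp1 hp2
    rw [continuous_pi_iff]
    intro i
    simp only [comb_apply]
    fin_cases i <;> simp [A, B, S] <;> fun_prop
  · intro t ht x hx
    change _ ⬝ᵥ _ = 1
    rw [(hF _).dot_self]
    have := pc_norm k (xi x)
    rw [xi_norm_sq hx, Complex.normSq_apply] at this
    nlinarith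
  · intro x hx
    simp [powF, hS1]
  · intro x hx
    rw [powMap_eq]
    ext i; fin_cases i <;> simp [comb_apply, A, B, S]

lemma powF_perp {a b s : V3} (F : Frame3 a b s) (k : ℤ) (x : V3) :
    perp a b (powF a b s k x) = pc k (xi x) := by
  simp [perp, powF, F.dot_a, F.dot_b]

lemma hopf_perp_eq {a b s : V3} (F : Frame3 a b s) (p q : ℂ) :
    perp a b (hopf a b s p q) =
      ((2 / (Complex.normSq p + Complex.normSq q) : ℝ) : ℂ) * (p * conj q) := by
  rw [perp, hopf, F.dot_a, F.dot_b]
  apply Complex.ext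
  · rw [Complex.re_ofReal_mul]; ring
  · rw [Complex.im_ofReal_mul]; ring

def Wm (ζ : ℝ → ℂ) (x : V3) : ℂ := ((kap x * ‖xi x‖ : ℝ) : ℂ) * ζ (Complex.arg (xi x))

def qpoly (Yp Yn : Finset ℂ) (u : ℝ) (w : ℂ) : ℂ :=
  (∏ η ∈ Yp, conj (w - u * η)) * ∏ η ∈ Yn, (w - u * η)

lemma qpoly_cont (Yp Yn : Finset ℂ) : Continuous fun p : ℝ × ℂ => qpoly Yp Yn p.1 p.2 := by
  unfold qpoly
  refine Continuous.mul (continuous_finsetProd _ fun η _ => ?_)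
    (continuous_finsetProd _ fun η _ => ?_)
  · exact Complex.continuous_conj.comp (by fun_prop)
  · fun_prop

lemma qpoly_eq_zero {Yp Yn : Finset ℂ} {u : ℝ} {w : ℂ} :
    qpoly Yp Yn u w = 0 ↔ ∃ η ∈ Yp ∪ Yn, w = u * η := by
  simp only [qpoly, mul_eq_zero, Finset.prod_eq_zero_iff, Finset.mem_union,
    map_eq_zero, sub_eq_zero]
  constructor
  · rintro (⟨η, h, e⟩ | ⟨η, h, e⟩)
    · exact ⟨η, Or.inl h, e⟩
    · exact ⟨η, Or.inr h, e⟩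
  · rintro ⟨η, h | h, e⟩
    · exact Or.inl ⟨η, h, e⟩
    · exact Or.inr ⟨η, h, e⟩

/-- family of loops interpolating to the round circle -/
def zt (m : ℝ → ℂ) (t φ : ℝ) : ℂ := Complex.exp (((1 - t : ℝ) : ℂ) * m φ + φ * Complex.I)

lemma Wzt_cont {m : ℝ → ℂ} (hm : Continuous m) (hper : ∀ φ, m (φ + 2 * Real.pi) = m φ) :
    ContinuousOn (fun p : ℝ × V3 => Wm (zt m p.1) p.2) (univ ×ˢ {x | -1 < x 2}) := by
  have h1 : Continuous fun p : ℝ × ℂ => (‖p.2‖ : ℂ) * zt m p.1 (Complex.arg p.2) := by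
    refine polar_cont (T := ℝ) (G := fun t φ ρ => (ρ : ℂ) * zt m t φ) ?_ ?_ ?_
    · unfold zt
      fun_prop
    · intro t φ ρ
      congr 1
      unfold zt
      rw [hper, show (((1 - t : ℝ) : ℂ) * m φ + ((φ + 2 * Real.pi : ℝ) : ℂ) * Complex.I) =
        (((1 - t : ℝ) : ℂ) * m φ + φ * Complex.I) + 2 * Real.pi * Complex.I by push_cast; ring]
      rw [Complex.exp_add, Complex.exp_two_pi_mul_I, mul_one]
    · intro t φ; simp
  have h2 : Continuous fun p : ℝ × V3 => (‖xi p.2‖ : ℂ) * zt m p.1 (Complex.arg (xi p.2)) :=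
    h1.comp (continuous_fst.prodMk (xi_cont.comp continuous_snd))
  have h3 : ContinuousOn (fun p : ℝ × V3 => (kap p.2 : ℂ)) (univ ×ˢ {x | -1 < x 2}) :=
    Complex.continuous_ofReal.comp_continuousOn
      (kap_contOn.comp continuousOn_snd fun p hp => hp.2)
  refine (h3.mul h2.continuousOn).congr ?_
  intro p hp
  simp only [Wm, Pi.mul_apply]; push_cast; ring

lemma Wzt_norm_ne {m : ℝ → ℂ} {t : ℝ} {x : V3} (hx : x ∈ sphereS) (h1 : -1 < x 2)
    (h0 : x 2 ≤ 0) : Wm (zt m t) x ≠ 0 := by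
  unfold Wm zt
  have := kap_low hx h1 h0
  refine mul_ne_zero ?_ (Complex.exp_ne_zero _)
  exact_mod_cast (by linarith : (kap x * ‖xi x‖) ≠ 0)

lemma zt_one (m : ℝ → ℂ) (φ : ℝ) : zt m 1 φ = Complex.exp (φ * Complex.I) := by simp [zt]

lemma final_conj {m : ℝ → ℂ} {Yp Yn : Finset ℂ} {x : V3} (h : 0 ≤ x 2) :
    conj (qpoly Yp Yn 0 (Wm (zt m 1) x) * (Complex.normSq (Wm (zt m 1) x) : ℂ)) =
      ((‖xi x‖ ^ (Yp.card + Yn.card + 2) : ℝ) : ℂ) *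
      Complex.exp (((((Yp.card : ℤ) - (Yn.card : ℤ) : ℤ) * Complex.arg (xi x) : ℝ) : ℂ) *
        Complex.I) := by
  have hW : Wm (zt m 1) x = (‖xi x‖ : ℂ) * Complex.exp (Complex.arg (xi x) * Complex.I) := by
    rw [Wm, zt_one, kap_up h, one_mul]
  have hc : conj (Wm (zt m 1) x) =
      (‖xi x‖ : ℂ) * Complex.exp (-(Complex.arg (xi x) * Complex.I)) := by
    rw [hW, map_mul, Complex.conj_ofReal, ← Complex.exp_conj]; simp
  have hn : (Complex.normSq (Wm (zt m 1) x) : ℂ) = (‖xi x‖ : ℂ) ^ 2 := by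
    rw [Complex.normSq_eq_norm_sq, hW, norm_mul, Complex.norm_exp_ofReal_mul_I]; simp
  have hq : conj (qpoly Yp Yn 0 (Wm (zt m 1) x)) =
      (Wm (zt m 1) x) ^ Yp.card * (conj (Wm (zt m 1) x)) ^ Yn.card := by
    simp [qpoly]
  rw [map_mul, hq, hc, hn, hW, map_pow, Complex.conj_ofReal, mul_pow, mul_pow, ← Complex.exp_nat_mul,
    ← Complex.exp_nat_mul]
  have he : Complex.exp (((((Yp.card : ℤ) - (Yn.card : ℤ) : ℤ) * Complex.arg (xi x) : ℝ) : ℂ) *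
        Complex.I) = Complex.exp (Yp.card * (Complex.arg (xi x) * Complex.I)) *
        Complex.exp (Yn.card * (-(Complex.arg (xi x) * Complex.I))) := by
    rw [← Complex.exp_add]; congr 1; push_cast; ring
  rw [he]; push_cast; ring

theorem core {deg : (V3 → V3) → ℤ} (hdeg : DegreeTheory deg) {a b s : V3} (F : Frame3 a b s)
    (hpow : ∀ k, SphHomotopic (powF a b s k) (powMap k)) {m : ℝ → ℂ} (hm : Continuous m)
    (hper : ∀ φ, m (φ + 2 * Real.pi) = m φ) {Yp Yn : Finset ℂ}
    (hη : ∀ η ∈ Yp ∪ Yn, ∀ φ, ∀ l ∈ Icc (0:ℝ) 1, zt m 0 φ ≠ (l : ℂ) * η)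
    {L : ℂ → ℂ} (hL : Continuous L) {f : V3 → V3} (hf : ContinuousOn f sphereS)
    (hmf : MapsTo f sphereS sphereS)
    (hY : ∀ x ∈ sphereS, f x = s ↔ 0 ≤ x 2 ∧ Wm (zt m 0) x ∈ Yp ∪ Yn)
    (hloc : ∀ y ∈ sphereS, 0 ≤ y 2 → Wm (zt m 0) y ∈ Yp ∪ Yn → ∀ᶠ x in 𝓝[sphereS] y,
      0 ≤ (perp a b (f x) * conj (Complex.exp (L (Wm (zt m 0) x)) *
        conj (qpoly Yp Yn 1 (Wm (zt m 0) x)))).re) :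
    deg f = (Yp.card : ℤ) - (Yn.card : ℤ) := by
  have hWc := Wzt_cont hm hper
  have hsec : ∀ t : ℝ, ContinuousOn (fun p : ℝ × V3 => Wm (zt m t) p.2)
      (univ ×ˢ {x | -1 < x 2}) := by
    intro t
    exact hWc.comp (f := fun p : ℝ × V3 => (t, p.2)) (by fun_prop) (fun p hp => ⟨mem_univ _, hp.2⟩)
  have hqne : ∀ u ∈ Icc (0:ℝ) 1, ∀ x ∈ sphereS, -1 < x 2 → x 2 ≤ 0 →
      qpoly Yp Yn u (Wm (zt m 0) x) ≠ 0 := by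
    intro u hu x hx h1 h0 e
    obtain ⟨η, hmem, e⟩ := qpoly_eq_zero.mp e
    have hk := kap_low hx h1 h0
    have hkc : ((kap x * ‖xi x‖ : ℝ) : ℂ) ≠ 0 := by
      exact_mod_cast (by linarith : (kap x * ‖xi x‖) ≠ 0)
    refine hη η hmem (Complex.arg (xi x)) (u / (kap x * ‖xi x‖)) ⟨?_, ?_⟩ ?_
    · exact div_nonneg hu.1 (by linarith)
    · rw [div_le_one (by linarith)]; linarith [hu.2]
    · rw [Wm] at e
      rw [Complex.ofReal_div, div_mul_eq_mul_div, eq_div_iff hkc, mul_comm]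
      exact e
  -- first deformation
  have hBC := hopf_homotopy F
    (E := fun t x => Complex.exp (((1 - t : ℝ) : ℂ) * L (Wm (zt m 0) x)))
    (Q := fun t x => qpoly Yp Yn (1 - t) (Wm (zt m 0) x))
    (by
      have h1 := hL.comp_continuousOn (hsec 0)
      refine Complex.continuous_exp.comp_continuousOn (ContinuousOn.mul ?_ h1)
      fun_prop)
    (by
      exact (qpoly_cont Yp Yn).comp_continuousOn
        (f := fun p : ℝ × V3 => (1 - p.1, Wm (zt m 0) p.2))
        (ContinuousOn.prodMk (by fun_prop) (hsec 0)))
    (fun t _ x _ _ => Complex.exp_ne_zero _)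
    (fun t ht x hx h1 h0 => hqne (1 - t) ⟨by linarith [ht.2], by linarith [ht.1]⟩ x hx h1 h0)
  have hq0ne : ∀ (t : ℝ) (x : V3), Wm (zt m t) x ≠ 0 → qpoly Yp Yn 0 (Wm (zt m t) x) ≠ 0 := by
    intro t x h e
    obtain ⟨η, _, e⟩ := qpoly_eq_zero.mp e
    exact h (by simpa using e)
  have hDD := hopf_homotopy F
    (E := fun _ _ => 1)
    (Q := fun t x => qpoly Yp Yn 0 (Wm (zt m t) x) *
      (((1 - t) + t * Complex.normSq (Wm (zt m t) x) : ℝ) : ℂ))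
    continuousOn_const
    (by
      refine ContinuousOn.mul ?_ (Complex.continuous_ofReal.comp_continuousOn ?_)
      · exact (qpoly_cont Yp Yn).comp_continuousOn
          (f := fun p : ℝ × V3 => (0, Wm (zt m p.1) p.2))
          (ContinuousOn.prodMk continuousOn_const hWc)
      · have h1 : ContinuousOn (fun p : ℝ × V3 => Complex.normSq (Wm (zt m p.1) p.2))
          (univ ×ˢ {x | -1 < x 2}) := Complex.continuous_normSq.comp_continuousOn hWc
        fun_prop)
    (fun t _ x _ _ => one_ne_zero)
    (by
      intro t ht x hx h1 h0
      have hne := Wzt_norm_ne (m := m) (t := t) hx h1 h0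
      refine mul_ne_zero (hq0ne t x hne) ?_
      have hp := Complex.normSq_pos.mpr hne
      have h2 := ht.1
      have h3 : 0 ≤ 1 - t := by linarith [ht.2]
      have : 0 < (1 - t) + t * Complex.normSq (Wm (zt m t) x) := by
        rcases h3.lt_or_eq with h | h
        · positivity
        · have : t = 1 := by linarith
          subst this; simpa using hp
      exact_mod_cast this.ne')
  have e1 : hopfMap a b s (fun x => Complex.exp (((1 - 1 : ℝ) : ℂ) * L (Wm (zt m 0) x)))
      (fun x => qpoly Yp Yn (1 - 1) (Wm (zt m 0) x)) =
      hopfMap a b s (fun _ => 1) (fun x => qpoly Yp Yn 0 (Wm (zt m 0) x) *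
      (((1 - 0) + 0 * Complex.normSq (Wm (zt m 0) x) : ℝ) : ℂ)) := by
    congr 1
    · funext x; simp
    · funext x; simp
  -- last step
  set Q3 : V3 → ℂ := fun x => qpoly Yp Yn 0 (Wm (zt m 1) x) *
      (((1 - 1) + 1 * Complex.normSq (Wm (zt m 1) x) : ℝ) : ℂ) with hQ3
  have hQ3e : ∀ x, Q3 x = qpoly Yp Yn 0 (Wm (zt m 1) x) *
      (Complex.normSq (Wm (zt m 1) x) : ℂ) := by
    intro x; simp [hQ3]
  set k : ℤ := (Yp.card : ℤ) - (Yn.card : ℤ) with hk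
  have hQ3low : ∀ x ∈ sphereS, -1 < x 2 → x 2 ≤ 0 → Q3 x ≠ 0 := by
    intro x hx h1 h0
    have hne := Wzt_norm_ne (m := m) (t := 1) hx h1 h0
    rw [hQ3e]
    refine mul_ne_zero (hq0ne 1 x hne) ?_
    exact_mod_cast (Complex.normSq_pos.mpr hne).ne'
  have hnegs : -s ≠ s := by
    intro e
    have h1 := F.ss
    have h2 : -s ⬝ᵥ s = 1 := by rw [e, h1]
    rw [neg_dotProduct, h1] at h2
    norm_num at h2
  have hlow : ∀ x ∈ sphereS, x 2 ≤ 0 → ∀ E Q : V3 → ℂ, (-1 < x 2 → E x ≠ 0 ∧ Q x ≠ 0) →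
      hopfMap a b s E Q x ≠ s := by
    intro x hx h0 E Q hEQ
    by_cases h1 : -1 < x 2
    · rw [hopfMap_of fun _ => (hEQ h1).2]
      intro e
      exact (hEQ h1).2 ((hopf_eq_s F (Or.inr (hEQ h1).2)).mp e)
    · have h2 : x 2 ≤ -1/2 := by linarith
      simpa [hopfMap, h2] using hnegs
  have hup : ∀ x : V3, 0 < x 2 → ∀ E Q : V3 → ℂ, E x ≠ 0 →
      (hopfMap a b s E Q x = s ↔ Q x = 0) := by
    intro x h0 E Q hE
    rw [hopfMap_of fun h => absurd h (not_le.mpr h0)]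
    refine hopf_eq_s F (Or.inl ?_)
    rw [chi_up h0.le]; simpa using hE
  have hpos : ∀ y : V3, 0 < y 2 → ∀ᶠ x in 𝓝[sphereS] y, 0 < x 2 := by
    intro y hy
    apply mem_nhdsWithin_of_mem_nhds
    exact (isOpen_lt continuous_const (continuous_apply 2)).mem_nhds hy
  have hlast : SphHomotopic (hopfMap a b s (fun _ => 1) Q3) (powF a b s k) := by
    obtain ⟨c3, m3⟩ := sphHom_right hDD
    obtain ⟨c4, m4⟩ := sphHom_left (hpow k)
    have hiff : ∀ x ∈ sphereS, hopfMap a b s (fun _ => 1) Q3 x = s ↔ x 2 = 1 := by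
      intro x hx
      rcases le_or_gt (x 2) 0 with h0 | h0
      · have h1 := hlow x hx h0 (fun _ => 1) Q3 fun h => ⟨one_ne_zero, hQ3low x hx h h0⟩
        exact iff_of_false h1 (by linarith)
      · rw [hup x h0 (fun _ => 1) Q3 one_ne_zero]
        have hn := xi_norm_sq hx
        have hWn : Complex.normSq (Wm (zt m 1) x) = ‖xi x‖ ^ 2 := by
          rw [Complex.normSq_eq_norm_sq, Wm, zt_one, kap_up h0.le, norm_mul,
            Complex.norm_exp_ofReal_mul_I]; simp
        have hQW : Q3 x = 0 ↔ Wm (zt m 1) x = 0 := by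
          rw [hQ3e]
          constructor
          · intro e
            by_contra h
            rcases mul_eq_zero.mp e with e | e
            · exact hq0ne 1 x h e
            · exact h (by simpa using e)
          · intro e; rw [e]; simp
        rw [hQW, ← Complex.normSq_eq_zero, hWn, hn]
        constructor
        · intro h; nlinarith
        · intro h; rw [h]; norm_num
    refine interp F c3 c4 m3 m4 ?_ ?_
    · intro x hx
      rw [hiff x hx]
      constructor
      · intro h
        have hn := xi_norm_sq hx
        rw [h] at hn
        have : xi x = 0 := by simpa using hn
        ext i
        simp [powF, comb_apply, pc, this, h]
      · intro h
        have h2 : powF a b s k x ⬝ᵥ s = 1 := by rw [h, F.ss]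
        rwa [powF, F.dot_s] at h2
    · intro y hy hys
      have hy2 := (hiff y hy).mp hys
      filter_upwards [hpos y (by linarith)] with x hx
      rw [hopfMap_of fun h => absurd h (not_le.mpr hx), hopf_perp_eq F, powF_perp F, hQ3e,
        final_conj hx.le, chi_up hx.le]
      have hpc : conj (pc k (xi x)) = (‖xi x‖ : ℂ) * conj (Complex.exp
          (((k * Complex.arg (xi x) : ℝ) : ℂ) * Complex.I)) := by
        rw [pc, map_mul, Complex.conj_ofReal]
      rw [hpc]
      set e := Complex.exp (((k * Complex.arg (xi x) : ℝ) : ℂ) * Complex.I)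
      have he : e * conj e = 1 := by
        rw [Complex.mul_conj, Complex.normSq_eq_norm_sq, Complex.norm_exp_ofReal_mul_I]; simp
      set c := (2 / (Complex.normSq (((1 : ℝ) : ℂ) * 1) + Complex.normSq
        (qpoly Yp Yn 0 (Wm (zt m 1) x) * (Complex.normSq (Wm (zt m 1) x) : ℂ))) : ℝ) with hc
      have hc0 : 0 ≤ c := by
        rw [hc]
        exact div_nonneg (by norm_num) (add_nonneg (Complex.normSq_nonneg _)
          (Complex.normSq_nonneg _))
      have : (c : ℂ) * ((((1 : ℝ) : ℂ) * 1) * (((‖xi x‖ ^ (Yp.card + Yn.card + 2) : ℝ) : ℂ) * e)) *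
          ((‖xi x‖ : ℂ) * conj e) =
          ((c * ‖xi x‖ ^ (Yp.card + Yn.card + 2) * ‖xi x‖ : ℝ) : ℂ) := by
        push_cast
        linear_combination (c : ℂ) * (‖xi x‖ : ℂ) ^ (Yp.card + Yn.card + 2) * ‖xi x‖ * he
      rw [this, Complex.ofReal_re]
      positivity
  -- first step
  have hfirst : SphHomotopic f (hopfMap a b s
      (fun x => Complex.exp (((1 - 0 : ℝ) : ℂ) * L (Wm (zt m 0) x)))
      (fun x => qpoly Yp Yn (1 - 0) (Wm (zt m 0) x))) := by
    obtain ⟨c3, m3⟩ := sphHom_left hBC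
    have hy2 : ∀ x ∈ sphereS, 0 ≤ x 2 → Wm (zt m 0) x ∈ Yp ∪ Yn → 0 < x 2 := by
      intro x hx h0 hW
      rcases h0.lt_or_eq with h | h
      · exact h
      · exfalso
        refine hqne 1 (by simp) x hx (by linarith) (by linarith) ?_
        exact qpoly_eq_zero.mpr ⟨_, hW, by simp⟩
    refine interp F hf c3 hmf m3 ?_ ?_
    · intro x hx
      rw [hY x hx]
      rcases le_or_gt (x 2) 0 with h0 | h0
      · have := hlow x hx h0 (fun x => Complex.exp (((1 - 0 : ℝ) : ℂ) * L (Wm (zt m 0) x)))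
          (fun x => qpoly Yp Yn (1 - 0) (Wm (zt m 0) x)) fun h1 => ⟨Complex.exp_ne_zero
          (((1 - 0 : ℝ) : ℂ) * L (Wm (zt m 0) x)), hqne (1 - 0) (by simp) x hx h1 h0⟩
        refine iff_of_false ?_ this
        rintro ⟨h1, h2⟩
        linarith [hy2 x hx h1 h2]
      · rw [hup x h0 _ _ (Complex.exp_ne_zero _), qpoly_eq_zero]
        simp [h0.le]
    · intro y hy hys
      obtain ⟨h0, hW⟩ := (hY y hy).mp hys
      filter_upwards [hloc y hy h0 hW, hpos y (hy2 y hy h0 hW)] with x hx hx2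
      rw [hopfMap_of fun h => absurd h (not_le.mpr hx2), hopf_perp_eq F, chi_up hx2.le]
      simp only [sub_zero, Complex.ofReal_one, one_mul]
      rw [map_mul, Complex.conj_ofReal, mul_left_comm, Complex.re_ofReal_mul]
      refine mul_nonneg ?_ hx
      exact div_nonneg (by norm_num) (add_nonneg (Complex.normSq_nonneg _)
          (Complex.normSq_nonneg _))
  rw [deg_of_hom hdeg hfirst, deg_of_hom hdeg hBC, e1, deg_of_hom hdeg hDD,
    deg_of_hom hdeg hlast, deg_of_hom hdeg (hpow k), hdeg.2 k]

lemma mul_sinc (x : ℝ) : x * Real.sinc x = Real.sin x := by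
  rcases eq_or_ne x 0 with rfl | h
  · simp
  · rw [Real.sinc_of_ne_zero h]; field_simp

def gco (α ρ : ℝ) : ℝ := ρ * Real.sinc (ρ * α) / Real.sinc α

def geoF (p a : V3) (ρ : ℝ) : V3 :=
  gco (Real.arccos (p ⬝ᵥ a)) (1 - ρ) • p + gco (Real.arccos (p ⬝ᵥ a)) ρ • a

lemma sph_dot_lt {p a : V3} (hp : p ∈ sphereS) (ha : a ∈ sphereS) (h : a ≠ p) : a ⬝ᵥ p < 1 := by
  have hp' : p ⬝ᵥ p = 1 := hp
  have ha' : a ⬝ᵥ a = 1 := ha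
  have h1 : a ⬝ᵥ p ≤ 1 := by
    simp only [dot3] at *
    nlinarith [sq_nonneg (a 0 - p 0), sq_nonneg (a 1 - p 1), sq_nonneg (a 2 - p 2)]
  rcases h1.lt_or_eq with h2 | h2
  · exact h2
  · exact absurd (sphere_eq_s hp' ha (by linarith)) h

lemma sph_neg {p : V3} (hp : p ∈ sphereS) : -p ∈ sphereS := by
  have hp' : p ⬝ᵥ p = 1 := hp
  change -p ⬝ᵥ -p = 1
  simpa using hp'

lemma sph_neg_ne {p : V3} (hp : p ∈ sphereS) : -p ≠ p := by
  have hp' : p ⬝ᵥ p = 1 := hp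
  intro e
  have h2 : -p ⬝ᵥ p = 1 := by rw [e, hp']
  rw [neg_dotProduct, hp'] at h2
  norm_num at h2

/-- Basic facts on the angle. -/
lemma ang_facts {p a : V3} (hp : p ∈ sphereS) (ha : a ∈ sphereS) (h : a ≠ -p) :
    Real.cos (Real.arccos (p ⬝ᵥ a)) = p ⬝ᵥ a ∧ Real.arccos (p ⬝ᵥ a) < Real.pi ∧
    0 < Real.sinc (Real.arccos (p ⬝ᵥ a)) := by
  have h1 := sph_dot_lt (sph_neg hp) ha h
  rw [dotProduct_neg, dotProduct_comm] at h1
  have h2 : p ⬝ᵥ a ≤ 1 := by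
    by_cases e : a = p
    · have hp' : p ⬝ᵥ p = 1 := hp
      rw [e, hp']
    · rw [dotProduct_comm]; exact (sph_dot_lt hp ha e).le
  have h3 : Real.arccos (p ⬝ᵥ a) < Real.pi := by
    rcases (Real.arccos_le_pi (p ⬝ᵥ a)).lt_or_eq with h | h
    · exact h
    · rw [Real.arccos_eq_pi] at h; linarith
  refine ⟨Real.cos_arccos (by linarith) h2, h3, ?_⟩
  rcases (Real.arccos_nonneg (p ⬝ᵥ a)).lt_or_eq with h | h
  · rw [Real.sinc_of_ne_zero h.ne']
    exact div_pos (Real.sin_pos_of_pos_of_lt_pi h h3) h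
  · rw [← h]; simp

lemma geo_eq {p a : V3} (hp : p ∈ sphereS) (ha : a ∈ sphereS) (h : a ≠ -p) (ρ : ℝ) :
    geo p a ρ = geoF p a ρ := by
  have hp' : p ⬝ᵥ p = 1 := hp
  unfold geo geoF
  split_ifs with e
  · subst e
    rw [hp']
    simp [gco, ← add_smul]
  · obtain ⟨h1, h2, h3⟩ := ang_facts hp ha h
    have h4 : Real.arccos (p ⬝ᵥ a) ≠ 0 := by
      intro e2
      rw [Real.arccos_eq_zero, dotProduct_comm] at e2
      linarith [sph_dot_lt hp ha (Ne.symm e)]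
    have key : ∀ r : ℝ, Real.sin (r * Real.arccos (p ⬝ᵥ a)) / Real.sin (Real.arccos (p ⬝ᵥ a)) =
        gco (Real.arccos (p ⬝ᵥ a)) r := by
      intro r
      rw [gco, ← mul_sinc (r * _), ← mul_sinc (Real.arccos (p ⬝ᵥ a))]
      field_simp
    rw [key, key]

lemma gco_trig {α ρ : ℝ} (h : Real.sinc α ≠ 0) :
    gco α (1 - ρ) ^ 2 + gco α ρ ^ 2 + 2 * gco α (1 - ρ) * gco α ρ * Real.cos α = 1 := by
  rcases eq_or_ne α 0 with rfl | h0
  · simp [gco]; ring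
  have hs : Real.sin α ≠ 0 := by
    rw [← mul_sinc]; exact mul_ne_zero h0 h
  have key : ∀ r : ℝ, gco α r = Real.sin (r * α) / Real.sin α := by
    intro r
    rw [gco, ← mul_sinc (r * _), ← mul_sinc α]
    field_simp
  rw [key, key]
  have e1 : Real.sin α = Real.sin ((1 - ρ) * α) * Real.cos (ρ * α) +
    Real.cos ((1 - ρ) * α) * Real.sin (ρ * α) := by rw [← Real.sin_add]; congr 1; ring
  have e2 : Real.cos α = Real.cos ((1 - ρ) * α) * Real.cos (ρ * α) -
    Real.sin ((1 - ρ) * α) * Real.sin (ρ * α) := by rw [← Real.cos_add]; congr 1; ring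
  have p1 := Real.sin_sq_add_cos_sq ((1 - ρ) * α)
  have p2 := Real.sin_sq_add_cos_sq (ρ * α)
  field_simp
  rw [e1, e2]
  generalize Real.sin ((1 - ρ) * α) = A at *
  generalize Real.cos ((1 - ρ) * α) = B at *
  generalize Real.sin (ρ * α) = C at *
  generalize Real.cos (ρ * α) = D at *
  linear_combination (-A^2) * p2 - C^2 * p1

lemma gco_nonneg {α ρ : ℝ} (h0 : 0 ≤ α) (h1 : α < Real.pi) (hρ : ρ ∈ Icc (0:ℝ) 1) :
    0 ≤ gco α ρ := by
  have key : ∀ x, 0 ≤ x → x < Real.pi → 0 ≤ Real.sinc x := by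
    intro x hx hx1
    rcases hx.lt_or_eq with h | h
    · rw [Real.sinc_of_ne_zero h.ne']
      exact div_nonneg (Real.sin_nonneg_of_nonneg_of_le_pi hx hx1.le) hx
    · rw [← h]; simp
  refine div_nonneg (mul_nonneg hρ.1 (key _ (mul_nonneg hρ.1 h0) ?_)) (key _ h0 h1)
  nlinarith [hρ.2]

lemma geoF_sph {p a : V3} (hp : p ∈ sphereS) (ha : a ∈ sphereS) (h : a ≠ -p) (ρ : ℝ) :
    geoF p a ρ ∈ sphereS := by
  obtain ⟨h1, h2, h3⟩ := ang_facts hp ha h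
  have := gco_trig (ρ := ρ) h3.ne'
  have hp' : p ⬝ᵥ p = 1 := hp
  have ha' : a ⬝ᵥ a = 1 := ha
  change geoF p a ρ ⬝ᵥ geoF p a ρ = 1
  unfold geoF
  generalize gco (Real.arccos (p ⬝ᵥ a)) (1 - ρ) = A at *
  generalize gco (Real.arccos (p ⬝ᵥ a)) ρ = B at *
  rw [h1] at this
  simp only [dotProduct_add, add_dotProduct, smul_dotProduct, dotProduct_smul, smul_eq_mul,
    hp', ha', dotProduct_comm a p]
  linarith

lemma geoF_ne {p a : V3} (hp : p ∈ sphereS) (ha : a ∈ sphereS) (h : a ≠ -p) {ρ : ℝ}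
    (hρ : ρ ∈ Icc (0:ℝ) 1) : geoF p a ρ ≠ -p := by
  obtain ⟨h1, h2, h3⟩ := ang_facts hp ha h
  have hA := gco_nonneg (Real.arccos_nonneg (p ⬝ᵥ a)) h2 (ρ := 1 - ρ)
    ⟨by linarith [hρ.2], by linarith [hρ.1]⟩
  have hB := gco_nonneg (Real.arccos_nonneg (p ⬝ᵥ a)) h2 hρ
  unfold geoF
  generalize gco (Real.arccos (p ⬝ᵥ a)) (1 - ρ) = A at *
  generalize gco (Real.arccos (p ⬝ᵥ a)) ρ = B at *
  intro e
  have e2 : B • a = (1 + A) • (-p) := by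
    rw [add_smul, one_smul, smul_neg, ← e]
    rw [e]
    have : A • p + B • a = -p := e
    rw [← this]; abel
  have hp' : -p ⬝ᵥ -p = 1 := sph_neg hp
  have ha' : a ⬝ᵥ a = 1 := ha
  have e3 : (B • a) ⬝ᵥ (B • a) = ((1 + A) • (-p)) ⬝ᵥ ((1 + A) • (-p)) := by rw [e2]
  simp only [smul_dotProduct, dotProduct_smul, smul_eq_mul, hp', ha'] at e3
  have e4 : B = 1 + A := by nlinarith
  rw [← e4] at e2
  exact h (smul_right_injective V3 (by linarith : B ≠ 0) e2)

lemma geoF_zero {p a : V3} (hp : p ∈ sphereS) (ha : a ∈ sphereS) (h : a ≠ -p) :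
    geoF p a 0 = p := by
  obtain ⟨h1, h2, h3⟩ := ang_facts hp ha h
  simp [geoF, gco, div_self h3.ne']

lemma geoF_one {p a : V3} (hp : p ∈ sphereS) (ha : a ∈ sphereS) (h : a ≠ -p) :
    geoF p a 1 = a := by
  obtain ⟨h1, h2, h3⟩ := ang_facts hp ha h
  simp [geoF, gco, div_self h3.ne']

lemma geoF_cont {p : V3} (hp : p ∈ sphereS) {g : ℝ → V3} (hg : Continuous g)
    (hgs : ∀ φ, g φ ∈ sphereS) (hgn : ∀ φ, g φ ≠ -p) :
    Continuous fun q : ℝ × ℝ => geoF p (g q.1) q.2 := by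
  have hα : Continuous fun q : ℝ × ℝ => Real.arccos (p ⬝ᵥ g q.1) := by
    refine Real.continuous_arccos.comp ?_
    simp only [dot3]
    fun_prop
  have hs := Real.continuous_sinc
  have hne : ∀ q : ℝ × ℝ, Real.sinc (Real.arccos (p ⬝ᵥ g q.1)) ≠ 0 :=
    fun q => (ang_facts hp (hgs q.1) (hgn q.1)).2.2.ne'
  have hco : ∀ r : ℝ × ℝ → ℝ, Continuous r →
      Continuous fun q : ℝ × ℝ => gco (Real.arccos (p ⬝ᵥ g q.1)) (r q) := by
    intro r hr
    unfold gco
    exact (hr.mul (hs.comp (hr.mul hα))).div (hs.comp hα) hne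
  unfold geoF
  have h1 := hco (fun q => 1 - q.2) (by fun_prop)
  have h2 := hco (fun q => q.2) (by fun_prop)
  fun_prop

/-- Continuity and the basic properties of the glued map. -/
lemma wrap_facts {n : V3 → V3} {z : ℝ → V3} {ctr s : V3} (hs : s ∈ sphereS) (hz : Continuous z)
    (hzp : ∀ φ, z (φ + 2 * Real.pi) = z φ) {C : Set V3} (hn : ContinuousOn n C)
    (hnS : MapsTo n C sphereS) (hseg : ∀ φ, ∀ ρ ∈ Icc (0:ℝ) 1, ρ • z φ + (1 - ρ) • ctr ∈ C)
    (hne : ∀ φ, n (z φ) ≠ s) :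
    ContinuousOn (wrapMap n z ctr s) sphereS ∧ MapsTo (wrapMap n z ctr s) sphereS sphereS ∧
    ∀ x ∈ sphereS, x 2 < 0 → wrapMap n z ctr s x ≠ s := by
  have hzC : ∀ φ, z φ ∈ C := fun φ => by simpa using hseg φ 1 (by simp)
  have hns := sph_neg hs
  have hne' : ∀ φ, n (z φ) ≠ - -s := by simpa using hne
  have hgs : ∀ φ, n (z φ) ∈ sphereS := fun φ => hnS (hzC φ)
  have hg : Continuous fun φ => n (z φ) := hn.comp_continuous hz hzC
  have hw : ∀ x, wrapMap n z ctr s x = if 0 ≤ x 2 then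
      n (‖xi x‖ • z (Complex.arg (xi x)) + (1 - ‖xi x‖) • ctr) else
      geoF (-s) (n (z (Complex.arg (xi x)))) ‖xi x‖ := by
    intro x
    unfold wrapMap
    rw [xi_norm]
    simp only [geo_eq hns (hgs _) (hne' _)]
    rfl
  have hnorm : ∀ x ∈ sphereS, ‖xi x‖ ∈ Icc (0:ℝ) 1 := by
    intro x hx
    have := xi_norm_sq hx
    exact ⟨norm_nonneg _, by nlinarith [norm_nonneg (xi x), sq_nonneg (x 2)]⟩
  have hup : Continuous fun ξ : ℂ => n ((min ‖ξ‖ 1) • z (Complex.arg ξ) + (1 - min ‖ξ‖ 1) • ctr) := by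
    have hmem : ∀ q : ℝ × ℝ, (max 0 (min q.2 1)) • z q.1 + (1 - max 0 (min q.2 1)) • ctr ∈ C := by
      intro q
      refine hseg _ _ ⟨le_max_left _ _, max_le (by norm_num) (min_le_right _ _)⟩
    have := polar_cont' (G := fun φ ρ => n ((max 0 (min ρ 1)) • z φ + (1 - max 0 (min ρ 1)) • ctr))
      (hn.comp_continuous (by fun_prop) hmem)
      (fun φ ρ => by rw [hzp]) (fun φ => by simp)
    refine this.congr fun ξ => ?_
    rw [max_eq_right (le_min (norm_nonneg _) zero_le_one)]
  have hlow : Continuous fun ξ : ℂ => geoF (-s) (n (z (Complex.arg ξ))) ‖ξ‖ := by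
    refine polar_cont' (G := fun φ ρ => geoF (-s) (n (z φ)) ρ) (geoF_cont (g := fun φ => n (z φ)) hns hg hgs hne') ?_ ?_
    · intro φ ρ; rw [hzp]
    · intro φ; rw [geoF_zero hns (hgs _) (hne' _), geoF_zero hns (hgs _) (hne' _)]
  refine ⟨?_, ?_, ?_⟩
  · have hc1 : ContinuousOn (fun x : V3 => if 0 ≤ x 2 then
      n ((min ‖xi x‖ 1) • z (Complex.arg (xi x)) + (1 - min ‖xi x‖ 1) • ctr) else
      geoF (-s) (n (z (Complex.arg (xi x)))) ‖xi x‖) sphereS := by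
      refine ContinuousOn.if ?_ ?_ ?_
      · rintro x ⟨hx, hx2⟩
        have h0 : x 2 = 0 := by
          have := frontier_le_subset_eq (continuous_const (y := (0:ℝ)))
            (continuous_apply (A := fun _ : Fin 3 => ℝ) 2) hx2
          exact this.symm
        have h1 : ‖xi x‖ = 1 := by
          have := xi_norm_sq hx
          rw [h0] at this
          nlinarith [norm_nonneg (xi x)]
        rw [h1, geoF_one hns (hgs _) (hne' _)]
        simp
      · exact (hup.comp xi_cont).continuousOn
      · exact (hlow.comp xi_cont).continuousOn
    refine hc1.congr fun x hx => ?_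
    simp only [hw, min_eq_left (hnorm x hx).2]
  · intro x hx
    rw [hw]
    split_ifs
    · exact hnS (hseg _ _ (hnorm x hx))
    · exact geoF_sph hns (hgs _) (hne' _) _
  · intro x hx h
    rw [hw, if_neg (not_le.mpr h)]
    have := geoF_ne hns (hgs (Complex.arg (xi x))) (hne' _) (hnorm x hx)
    simpa using this

lemma wrap_up {n : V3 → V3} {z : ℝ → V3} {ctr s x : V3} (h : 0 ≤ x 2) :
    wrapMap n z ctr s x = n (‖xi x‖ • z (Complex.arg (xi x)) + (1 - ‖xi x‖) • ctr) := by
  rw [xi_norm, wrapMap, if_pos h]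
  rfl

def iota (ctr e₁ e₂ : V3) (w : ℂ) : V3 := ctr + w.re • e₁ + w.im • e₂

lemma frame_of_pair {e₁ e₂ N : V3} (h1 : e₁ ⬝ᵥ e₁ = 1) (h2 : e₂ ⬝ᵥ e₂ = 1) (h12 : e₁ ⬝ᵥ e₂ = 0)
    (hN : crossProduct e₁ e₂ = N) : Frame3 e₁ e₂ N where
  aa := h1
  bb := h2
  ss := by rw [← hN, cross_dot_cross, h1, h2, h12, dotProduct_comm, h12]; norm_num
  ab := h12
  as := by rw [← hN]; exact dot_self_cross _ _
  bs := by rw [← hN]; exact dot_cross_self _ _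
  cr := hN

lemma loop_coords {N ctr e₁ e₂ : V3} {z : ℝ → V3} (hz : PosLoopParam N ctr z)
    (F : Frame3 e₁ e₂ N) : ∃ m : ℝ → ℂ, Continuous m ∧ (∀ φ, m (φ + 2 * Real.pi) = m φ) ∧
      ∀ φ, z φ = iota ctr e₁ e₂ (zt m 0 φ) := by
  obtain ⟨hzc, hzp, u, v, huu, hvv, huv, hN, θ, r, hθ, -, hθp, hr, hzr⟩ := hz
  have F' := frame_of_pair huu hvv huv hN
  have n1 := F.norm u
  have n2 := F.norm v
  rw [huu, F'.as] at n1
  rw [hvv, F'.bs] at n2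
  have hcr : (u ⬝ᵥ e₁) * (v ⬝ᵥ e₂) - (u ⬝ᵥ e₂) * (v ⬝ᵥ e₁) = 1 := by
    rw [← cross_dot_cross, hN, F.cr, F.ss]
  have d1 := F.decomp u
  have d2 := F.decomp v
  rw [F'.as] at d1
  rw [F'.bs] at d2
  generalize u ⬝ᵥ e₁ = c at *
  generalize u ⬝ᵥ e₂ = d at *
  generalize v ⬝ᵥ e₁ = p at *
  generalize v ⬝ᵥ e₂ = q at *
  have hp : p = -d := by nlinarith [sq_nonneg (p + d), sq_nonneg (q - c)]
  have hq : q = c := by nlinarith [sq_nonneg (p + d), sq_nonneg (q - c)]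
  subst hp hq
  obtain ⟨ψ, hc, hd⟩ : ∃ ψ : ℝ, q = Real.cos ψ ∧ d = Real.sin ψ := by
    have hn : ‖(⟨q, d⟩ : ℂ)‖ = 1 := by
      have : ‖(⟨q, d⟩ : ℂ)‖ ^ 2 = 1 := by
        rw [← Complex.normSq_eq_norm_sq, Complex.normSq_mk]; linarith
      nlinarith [norm_nonneg (⟨q, d⟩ : ℂ)]
    refine ⟨Complex.arg ⟨q, d⟩, ?_, ?_⟩
    · have := Complex.norm_mul_cos_arg ⟨q, d⟩
      rw [hn] at this; linarith
    · have := Complex.norm_mul_sin_arg ⟨q, d⟩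
      rw [hn] at this; linarith
  subst hc hd
  have hr2 : ∀ φ, r φ = Real.sqrt ((z φ - ctr) ⬝ᵥ (z φ - ctr)) := by
    intro φ
    rw [hzr φ, add_sub_cancel_left]
    rw [show (r φ • (Real.cos (θ φ) • u + Real.sin (θ φ) • v)) ⬝ᵥ
      (r φ • (Real.cos (θ φ) • u + Real.sin (θ φ) • v)) = r φ ^ 2 by
        simp only [dotProduct_add, add_dotProduct, smul_dotProduct, dotProduct_smul, smul_eq_mul,
          huu, hvv, huv, dotProduct_comm v u]
        linear_combination (r φ) ^ 2 * Real.sin_sq_add_cos_sq (θ φ)]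
    rw [Real.sqrt_sq (hr φ).le]
  have hrc : Continuous r := by
    rw [show r = fun φ => Real.sqrt ((z φ - ctr) ⬝ᵥ (z φ - ctr)) from funext hr2]
    simp only [dot3, Pi.sub_apply]
    fun_prop
  have hrp : ∀ φ, r (φ + 2 * Real.pi) = r φ := by
    intro φ; rw [hr2, hr2, hzp]
  refine ⟨fun φ => ((Real.log (r φ) : ℝ) : ℂ) + ((θ φ + ψ - φ : ℝ) : ℂ) * Complex.I, ?_, ?_, ?_⟩
  · have := hrc.log (fun φ => (hr φ).ne')
    fun_prop
  · intro φ
    simp only [hrp, hθp]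
    congr 3; ring
  · intro φ
    have hzt : zt (fun φ => ((Real.log (r φ) : ℝ) : ℂ) + ((θ φ + ψ - φ : ℝ) : ℂ) * Complex.I) 0 φ =
        ((r φ : ℝ) : ℂ) * Complex.exp (((θ φ + ψ : ℝ) : ℂ) * Complex.I) := by
      have : ((r φ : ℝ) : ℂ) = Complex.exp ((Real.log (r φ) : ℝ) : ℂ) := by
        rw [← Complex.ofReal_exp, Real.exp_log (hr φ)]
      rw [this, ← Complex.exp_add, zt]
      congr 1; push_cast; ring
    have hre : (zt (fun φ => ((Real.log (r φ) : ℝ) : ℂ) + ((θ φ + ψ - φ : ℝ) : ℂ) * Complex.I) 0 φ).re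
        = r φ * Real.cos (θ φ + ψ) := by
      rw [hzt, Complex.re_ofReal_mul, Complex.exp_ofReal_mul_I_re]
    have him : (zt (fun φ => ((Real.log (r φ) : ℝ) : ℂ) + ((θ φ + ψ - φ : ℝ) : ℂ) * Complex.I) 0 φ).im
        = r φ * Real.sin (θ φ + ψ) := by
      rw [hzt, Complex.im_ofReal_mul, Complex.exp_ofReal_mul_I_im]
    rw [iota, hre, him, hzr, Real.cos_add, Real.sin_add]
    ext i
    have a1 := congrFun d1 i
    have a2 := congrFun d2 i
    simp only [comb_apply] at a1 a2
    simp only [Pi.add_apply, Pi.smul_apply, smul_eq_mul, ← a1, ← a2]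
    ring

/-- Positivity near a regular zero. -/
lemma local_pos {N K T T' U : ℂ → ℂ} {D : ℂ →L[ℝ] ℂ} {η α β : ℂ} (hN : HasFDerivAt N D η)
    (hN0 : N η = 0) (hD : ∀ h, D h = α * T h + β * T' h) (hT' : ∀ h, ‖T' h‖ = ‖h‖)
    (hU : ∀ h, ‖U h‖ = ‖h‖) (hTU : ∀ h, T h * U h = ((‖h‖ ^ 2 : ℝ) : ℂ)) (hab : ‖β‖ < ‖α‖)
    (hK : ContinuousAt K η) (hKη : K η * α = 1) :
    ∀ᶠ w in 𝓝 η, 0 ≤ (N w * (K w * U (w - η))).re := by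
  set ε := (‖α‖ - ‖β‖) / 2 with hε
  have hε0 : 0 < ε := by rw [hε]; linarith
  have h1 := hN.isLittleO.def hε0
  have h2 : ContinuousAt (fun w => (K w * α).re - ‖K w * β‖ - ‖K w‖ * ε) η := by
    have h3 : ContinuousAt (fun w => (K w * α).re) η :=
      Complex.continuous_re.continuousAt.comp (hK.mul continuousAt_const)
    exact (h3.sub (hK.mul continuousAt_const).norm).sub (hK.norm.mul continuousAt_const)
  have h3 : 0 < (K η * α).re - ‖K η * β‖ - ‖K η‖ * ε := by
    have hk : ‖K η‖ * ‖α‖ = 1 := by rw [← norm_mul, hKη, norm_one]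
    rw [hKη, norm_mul, Complex.one_re]
    have hk0 : 0 < ‖K η‖ := by
      by_contra h
      have : ‖K η‖ = 0 := le_antisymm (not_lt.mp h) (norm_nonneg _)
      rw [this] at hk; simp at hk
    have : 0 < ‖K η‖ * ε := mul_pos hk0 hε0
    rw [hε] at *
    nlinarith
  filter_upwards [h1, h2.eventually (isOpen_Ioi.mem_nhds h3)] with w hw hw2
  have hw2' : 0 < (K w * α).re - ‖K w * β‖ - ‖K w‖ * ε := hw2
  set h := w - η
  set R := N w - N η - D h
  have e : N w * (K w * U h) = ((‖h‖ ^ 2 : ℝ) : ℂ) * (K w * α) + (K w * β) * (T' h * U h) +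
      K w * (R * U h) := by
    have : N w = D h + R := by simp [R, hN0]
    rw [this, hD, ← hTU]; ring
  rw [e, Complex.add_re, Complex.add_re, Complex.re_ofReal_mul]
  have b1 : -(‖K w * β‖ * ‖h‖ ^ 2) ≤ ((K w * β) * (T' h * U h)).re := by
    have := (abs_le.mp (Complex.abs_re_le_norm ((K w * β) * (T' h * U h)))).1
    rw [norm_mul, norm_mul (T' h), hT', hU] at this
    linarith
  have b2 : -(‖K w‖ * ε * ‖h‖ ^ 2) ≤ (K w * (R * U h)).re := by
    have h5 := (abs_le.mp (Complex.abs_re_le_norm (K w * (R * U h)))).1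
    rw [norm_mul, norm_mul R, hU] at h5
    have h6 : ‖K w‖ * (‖R‖ * ‖h‖) ≤ ‖K w‖ * ((ε * ‖h‖) * ‖h‖) := by gcongr
    nlinarith
  nlinarith [mul_nonneg hw2'.le (sq_nonneg ‖h‖)]

lemma isolated_zero {N : ℂ → ℂ} {D : ℂ →L[ℝ] ℂ} {η α β : ℂ} (hN : HasFDerivAt N D η)
    (hD : ∀ h, D h = α * h + β * conj h) (hab : ‖β‖ ≠ ‖α‖) :
    ∀ᶠ w in 𝓝[≠] η, N w ≠ 0 := by
  have h0 : 0 < |‖α‖ - ‖β‖| := abs_pos.mpr (sub_ne_zero.mpr hab.symm)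
  refine HasFDerivAt.eventually_ne hN ⟨Real.toNNReal |‖α‖ - ‖β‖|⁻¹,
    ContinuousLinearMap.antilipschitz_of_bound D fun h => ?_⟩
  rw [Real.coe_toNNReal _ (inv_nonneg.mpr h0.le), inv_mul_eq_div, le_div_iff₀ h0]
  have h1 := abs_norm_sub_norm_le (α * h) (-(β * conj h))
  rw [sub_neg_eq_add, ← hD, norm_neg, norm_mul, norm_mul, RCLike.norm_conj, ← sub_mul, abs_mul,
    abs_norm] at h1
  linarith

lemma iota_mul (ctr e₁ e₂ : V3) (r : ℝ) (w : ℂ) :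
    iota ctr e₁ e₂ ((r : ℂ) * w) = r • iota ctr e₁ e₂ w + (1 - r) • ctr := by
  ext i
  simp only [iota, Complex.re_ofReal_mul, Complex.im_ofReal_mul, Pi.add_apply, Pi.smul_apply,
    smul_eq_mul]
  ring

def iotaL (e₁ e₂ : V3) : ℂ →L[ℝ] V3 :=
  Complex.reCLM.smulRight e₁ + Complex.imCLM.smulRight e₂

lemma iotaL_apply (e₁ e₂ : V3) (h : ℂ) : iotaL e₁ e₂ h = h.re • e₁ + h.im • e₂ := by
  simp [iotaL]

lemma iota_fderiv (ctr e₁ e₂ : V3) (η : ℂ) :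
    HasFDerivAt (iota ctr e₁ e₂) (iotaL e₁ e₂) η := by
  have : iota ctr e₁ e₂ = fun w => ctr + iotaL e₁ e₂ w := by
    funext w; rw [iotaL_apply, iota, add_assoc]
  rw [this]
  exact (iotaL e₁ e₂).hasFDerivAt.const_add ctr

lemma iota_cont (ctr e₁ e₂ : V3) : Continuous (iota ctr e₁ e₂) := by unfold iota; fun_prop

def perpL (a b : V3) : V3 →L[ℝ] ℂ :=
  LinearMap.toContinuousLinearMap
    { toFun := perp a b
      map_add' := fun x y => by
        apply Complex.ext <;> simp [perp, add_dotProduct]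
      map_smul' := fun c x => by
        apply Complex.ext <;> simp [perp, smul_dotProduct] }

lemma perpL_apply (a b v : V3) : perpL a b v = perp a b v := rfl

def crd (ctr e₁ e₂ y : V3) : ℂ := perp e₁ e₂ (y - ctr)

lemma crd_cont (ctr e₁ e₂ : V3) : Continuous (crd ctr e₁ e₂) :=
  (perp_cont e₁ e₂).comp (continuous_id.sub continuous_const)

lemma iota_crd {ctr e₁ e₂ N y : V3} (F : Frame3 e₁ e₂ N) (hy : (y - ctr) ⬝ᵥ N = 0) :
    iota ctr e₁ e₂ (crd ctr e₁ e₂ y) = y := by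
  have h := F.decomp (y - ctr)
  rw [hy] at h
  ext i
  have := congrFun h i
  rw [comb_apply] at this
  simp only [Pi.sub_apply] at this
  simp only [iota, crd, perp, Pi.add_apply, Pi.smul_apply, smul_eq_mul]
  linarith

lemma crd_iota {ctr e₁ e₂ N : V3} (F : Frame3 e₁ e₂ N) (w : ℂ) :
    crd ctr e₁ e₂ (iota ctr e₁ e₂ w) = w := by
  have : iota ctr e₁ e₂ w - ctr = comb e₁ e₂ N w.re w.im 0 := by
    simp [iota, comb]; abel
  rw [crd, this, perp, F.dot_a, F.dot_b]

/-- The Wirtinger decomposition of the derivative in coordinates. -/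
lemma wirt {a b s e₁ e₂ : V3} (F : Frame3 a b s) (D : V3 →L[ℝ] V3) :
    ∃ α β : ℂ, (∀ h, (perpL a b ∘L D ∘L iotaL e₁ e₂) h = α * h + β * conj h) ∧
      ‖α‖ ^ 2 - ‖β‖ ^ 2 = crossProduct (D e₁) (D e₂) ⬝ᵥ s := by
  refine ⟨(perp a b (D e₁) - Complex.I * perp a b (D e₂)) / 2,
    (perp a b (D e₁) + Complex.I * perp a b (D e₂)) / 2, ?_, ?_⟩
  · intro h
    simp only [ContinuousLinearMap.comp_apply, iotaL_apply, map_add, map_smul, perpL_apply]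
    apply Complex.ext <;> simp <;> ring
  · rw [← Complex.normSq_eq_norm_sq, ← Complex.normSq_eq_norm_sq, ← F.cr, cross_dot_cross]
    simp [Complex.normSq_apply, perp]
    ring

lemma qpoly_factor_p {Yp Yn : Finset ℂ} {η : ℂ} (h : η ∈ Yp) (h' : η ∉ Yn) :
    ∃ κ : ℂ → ℂ, Continuous κ ∧ κ η ≠ 0 ∧ ∀ w, qpoly Yp Yn 1 w = κ w * conj (w - η) := by
  refine ⟨fun w => (∏ y ∈ Yp.erase η, conj (w - y)) * ∏ y ∈ Yn, (w - y), ?_, ?_, ?_⟩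
  · refine Continuous.mul (continuous_finsetProd _ fun y _ => ?_)
      (continuous_finsetProd _ fun y _ => ?_)
    · exact Complex.continuous_conj.comp (by fun_prop)
    · fun_prop
  · refine mul_ne_zero (Finset.prod_ne_zero_iff.mpr fun y hy => ?_)
      (Finset.prod_ne_zero_iff.mpr fun y hy => ?_)
    · rw [Ne, map_eq_zero, sub_eq_zero]
      exact fun e => (Finset.ne_of_mem_erase hy) e.symm
    · rw [sub_ne_zero]; rintro rfl; exact h' hy
  · intro w
    simp only [qpoly, Complex.ofReal_one, one_mul]
    rw [← Finset.mul_prod_erase Yp _ h]; ring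

lemma qpoly_factor_n {Yp Yn : Finset ℂ} {η : ℂ} (h : η ∉ Yp) (h' : η ∈ Yn) :
    ∃ κ : ℂ → ℂ, Continuous κ ∧ κ η ≠ 0 ∧ ∀ w, qpoly Yp Yn 1 w = κ w * (w - η) := by
  refine ⟨fun w => (∏ y ∈ Yp, conj (w - y)) * ∏ y ∈ Yn.erase η, (w - y), ?_, ?_, ?_⟩
  · refine Continuous.mul (continuous_finsetProd _ fun y _ => ?_)
      (continuous_finsetProd _ fun y _ => ?_)
    · exact Complex.continuous_conj.comp (by fun_prop)
    · fun_prop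
  · refine mul_ne_zero (Finset.prod_ne_zero_iff.mpr fun y hy => ?_)
      (Finset.prod_ne_zero_iff.mpr fun y hy => ?_)
    · rw [Ne, map_eq_zero, sub_eq_zero]
      rintro rfl; exact h hy
    · rw [sub_ne_zero]
      exact fun e => (Finset.ne_of_mem_erase hy) e.symm
  · intro w
    simp only [qpoly, Complex.ofReal_one, one_mul]
    rw [← Finset.mul_prod_erase Yn _ h']; ring

/-- The value of the interpolating factor needed at a regular zero. -/
lemma local_val {Nf : ℂ → ℂ} {D : ℂ →L[ℝ] ℂ} {η α β : ℂ} (hN : HasFDerivAt Nf D η)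
    (hN0 : Nf η = 0) (hD : ∀ h, D h = α * h + β * conj h) {Yp Yn : Finset ℂ}
    (h : (η ∈ Yp ∧ η ∉ Yn ∧ ‖β‖ < ‖α‖) ∨ (η ∉ Yp ∧ η ∈ Yn ∧ ‖α‖ < ‖β‖)) :
    ∃ v : ℂ, v ≠ 0 ∧ ∀ L : ℂ → ℂ, Continuous L → Complex.exp (L η) = v →
      ∀ᶠ w in 𝓝 η, 0 ≤ (Nf w * conj (Complex.exp (L w) * conj (qpoly Yp Yn 1 w))).re := by
  have hpos : ∀ {x y : ℂ}, ‖x‖ < ‖y‖ → y ≠ 0 := by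
    intro x y hxy e
    rw [e, norm_zero] at hxy
    exact absurd (norm_nonneg x) (not_le.mpr hxy)
  have hKc : ∀ {L κ : ℂ → ℂ}, Continuous L → Continuous κ →
      Continuous fun w => conj (Complex.exp (L w)) * κ w := by
    intro L κ hL hκ
    exact (Complex.continuous_conj.comp (Complex.continuous_exp.comp hL)).mul hκ
  rcases h with ⟨h1, h2, h3⟩ | ⟨h1, h2, h3⟩
  · obtain ⟨κ, hκ, hκ0, hq⟩ := qpoly_factor_p h1 h2
    have hα := hpos h3
    refine ⟨conj ((κ η * α)⁻¹), by simpa using And.intro hα hκ0, fun L hL hv => ?_⟩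
    have := local_pos (T := fun h => h) (T' := fun h => conj h) (U := fun h => conj h)
      (K := fun w => conj (Complex.exp (L w)) * κ w) hN hN0 hD
      (fun h => RCLike.norm_conj h) (fun h => RCLike.norm_conj h)
      (fun h => by rw [Complex.mul_conj, Complex.normSq_eq_norm_sq]) h3 (hKc hL hκ).continuousAt
      (by
        simp only [hv, Complex.conj_conj]
        rw [mul_assoc, inv_mul_cancel₀ (mul_ne_zero hκ0 hα)])
    filter_upwards [this] with w hw
    rw [map_mul, Complex.conj_conj, hq, ← mul_assoc (conj (Complex.exp (L w)))]
    exact hw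
  · obtain ⟨κ, hκ, hκ0, hq⟩ := qpoly_factor_n h1 h2
    have hβ := hpos h3
    refine ⟨conj ((κ η * β)⁻¹), by simpa using And.intro hβ hκ0, fun L hL hv => ?_⟩
    have := local_pos (T := fun h => conj h) (T' := fun h => h) (U := fun h => h)
      (K := fun w => conj (Complex.exp (L w)) * κ w) (α := β) (β := α) hN hN0
      (fun h => by rw [hD, add_comm])
      (fun h => rfl) (fun h => rfl)
      (fun h => by rw [mul_comm, Complex.mul_conj, Complex.normSq_eq_norm_sq]) h3
      (hKc hL hκ).continuousAt
      (by
        simp only [hv, Complex.conj_conj]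
        rw [mul_assoc, inv_mul_cancel₀ (mul_ne_zero hκ0 hβ)])
    filter_upwards [this] with w hw
    rw [map_mul, Complex.conj_conj, hq, ← mul_assoc (conj (Complex.exp (L w)))]
    exact hw

lemma exists_interp (Y : Finset ℂ) (v : ℂ → ℂ) (hv : ∀ η ∈ Y, v η ≠ 0) :
    ∃ L : ℂ → ℂ, Continuous L ∧ ∀ η ∈ Y, Complex.exp (L η) = v η := by
  refine ⟨fun w => (Lagrange.interpolate Y id fun η => Complex.log (v η)).eval w,
    Polynomial.continuous _, fun η hη => ?_⟩
  have := Lagrange.eval_interpolate_at_node (v := id) (fun η => Complex.log (v η))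
    (Function.injective_id.injOn (s := (Y : Set ℂ))) hη
  simp only [id] at this ⊢
  rw [this, Complex.exp_log (hv η hη)]

lemma finite_zeros {Y : Set ℂ} (hY : IsCompact Y) (h : ∀ η ∈ Y, ∀ᶠ w in 𝓝[≠] η, w ∉ Y) :
    Y.Finite := by
  by_contra hinf
  obtain ⟨η, hη, hacc⟩ := Set.Infinite.exists_accPt_of_subset_isCompact hinf hY subset_rfl
  rw [accPt_iff_frequently_nhdsNE] at hacc
  exact hacc (h η hη)

theorem planar {deg : (V3 → V3) → ℤ} (hdeg : DegreeTheory deg) {s : V3} (hs : s ∈ sphereS)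
    {N e₁ e₂ ctr : V3} (Fe : Frame3 e₁ e₂ N) {z : ℝ → V3} (hz : PosLoopParam N ctr z)
    {n : V3 → V3} {C : Set V3} (hCc : IsCompact C) (hCp : ∀ y ∈ C, (y - ctr) ⬝ᵥ N = 0)
    (hnS : MapsTo n C sphereS) (hd : DifferentiableOn ℝ n C)
    (hseg : ∀ φ, ∀ ρ ∈ Icc (0:ℝ) 1, ρ • z φ + (1 - ρ) • ctr ∈ C)
    (hne : ∀ φ, n (z φ) ≠ s)
    (hnb : ∀ η, iota ctr e₁ e₂ η ∈ C → n (iota ctr e₁ e₂ η) = s →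
      ∀ᶠ w in 𝓝 η, iota ctr e₁ e₂ w ∈ C)
    (hstar : ∀ η, iota ctr e₁ e₂ η ∈ C → n (iota ctr e₁ e₂ η) = s → ∀ φ, ∀ l ∈ Icc (0:ℝ) 1,
      z φ ≠ l • iota ctr e₁ e₂ η + (1 - l) • ctr)
    (hreg : ∀ y ∈ C, n y = s →
      crossProduct (fderivWithin ℝ n C y e₁) (fderivWithin ℝ n C y e₂) ⬝ᵥ s ≠ 0) :
    ∃ hfin : {y ∈ C | n y = s}.Finite,
      ((deg (wrapMap n z ctr s) : ℤ) : ℝ) = ∑ y ∈ hfin.toFinset,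
        Real.sign (crossProduct (fderivWithin ℝ n C y e₁) (fderivWithin ℝ n C y e₂) ⬝ᵥ s) := by
  obtain ⟨a, b, F, hpow⟩ := exists_frame hs
  obtain ⟨m, hm, hmp, hzm⟩ := loop_coords hz Fe
  set ι := iota ctr e₁ e₂ with hι
  set σ : V3 → ℝ := fun y =>
    crossProduct (fderivWithin ℝ n C y e₁) (fderivWithin ℝ n C y e₂) ⬝ᵥ s with hσ
  set Nf : ℂ → ℂ := fun w => perp a b (n (ι w)) with hNf
  have hperps : perp a b s = 0 := by
    apply Complex.ext
    · simp [perp, dotProduct_comm s, F.as]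
    · simp [perp, dotProduct_comm s, F.bs]
  set Y : Set ℂ := {η | ι η ∈ C ∧ n (ι η) = s} with hYdef
  have hder : ∀ η ∈ Y, ∃ (D : ℂ →L[ℝ] ℂ) (α β : ℂ), HasFDerivAt Nf D η ∧
      (∀ h, D h = α * h + β * conj h) ∧ ‖α‖ ^ 2 - ‖β‖ ^ 2 = σ (ι η) := by
    rintro η ⟨h1, h2⟩
    have hdn := (hd (ι η) h1).hasFDerivWithinAt
    obtain ⟨α, β, hD, hab⟩ := wirt (e₁ := e₁) (e₂ := e₂) F (fderivWithin ℝ n C (ι η))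
    refine ⟨_, α, β, ?_, hD, hab⟩
    have h3 : HasFDerivWithinAt ι (iotaL e₁ e₂) {w | ι w ∈ C} η :=
      (iota_fderiv ctr e₁ e₂ η).hasFDerivWithinAt
    have h4 := hdn.comp η h3 (fun w hw => hw)
    have h5 := h4.hasFDerivAt (hnb η h1 h2)
    exact (perpL a b).hasFDerivAt.comp η h5
  have hN0 : ∀ η ∈ Y, Nf η = 0 := by
    rintro η ⟨h1, h2⟩
    simp only [hNf, h2, hperps]
  have hZc : IsCompact {y ∈ C | n y = s} := by
    have : {y ∈ C | n y = s} = C ∩ n ⁻¹' {s} := rfl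
    rw [this]
    exact hCc.of_isClosed_subset
      (hd.continuousOn.preimage_isClosed_of_isClosed hCc.isClosed isClosed_singleton)
      inter_subset_left
  have hYim : Y = crd ctr e₁ e₂ '' {y ∈ C | n y = s} := by
    ext η
    constructor
    · rintro ⟨h1, h2⟩
      exact ⟨ι η, ⟨h1, h2⟩, crd_iota Fe η⟩
    · rintro ⟨y, ⟨h1, h2⟩, rfl⟩
      have := iota_crd Fe (hCp y h1)
      refine ⟨?_, ?_⟩
      · rw [hι, this]; exact h1
      · rw [hι, this]; exact h2
  have hYc : IsCompact Y := by
    rw [hYim]; exact hZc.image (crd_cont _ _ _)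
  have hσne : ∀ η ∈ Y, σ (ι η) ≠ 0 := fun η hη => hreg _ hη.1 hη.2
  have hYfin : Y.Finite := by
    refine finite_zeros hYc fun η hη => ?_
    obtain ⟨D, α, β, h1, h2, h3⟩ := hder η hη
    have h4 : ‖β‖ ≠ ‖α‖ := by
      intro e
      apply hσne η hη
      rw [← h3, e, sub_self]
    filter_upwards [isolated_zero h1 h2 h4] with w hw hwY
    exact hw (hN0 w hwY)
  have hZim : {y ∈ C | n y = s} = ι '' Y := by
    ext y
    constructor
    · rintro ⟨h1, h2⟩
      have := iota_crd Fe (hCp y h1)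
      refine ⟨crd ctr e₁ e₂ y, ?_, this⟩
      rw [hYim]; exact ⟨y, ⟨h1, h2⟩, rfl⟩
    · rintro ⟨η, ⟨h1, h2⟩, rfl⟩
      exact ⟨h1, h2⟩
  have hfin : {y ∈ C | n y = s}.Finite := by rw [hZim]; exact hYfin.image _
  refine ⟨hfin, ?_⟩
  set Yf := hYfin.toFinset with hYf
  set Yp := Yf.filter fun η => 0 < σ (ι η) with hYp
  set Yn := Yf.filter fun η => ¬ 0 < σ (ι η) with hYn
  have hYu : Yp ∪ Yn = Yf := Finset.filter_union_filter_not_eq _ _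
  have hmem : ∀ η, η ∈ Yp ∪ Yn ↔ η ∈ Y := by
    intro η; rw [hYu, hYf]; simp
  -- the interpolating factor
  have hloc : ∀ η ∈ Y, ∃ v : ℂ, v ≠ 0 ∧ ∀ L : ℂ → ℂ, Continuous L → Complex.exp (L η) = v →
      ∀ᶠ w in 𝓝 η, 0 ≤ (Nf w * conj (Complex.exp (L w) * conj (qpoly Yp Yn 1 w))).re := by
    intro η hη
    obtain ⟨D, α, β, h1, h2, h3⟩ := hder η hη
    have hηf : η ∈ Yf := by rw [hYf]; simpa using hη
    refine local_val h1 (hN0 η hη) h2 ?_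
    by_cases hp : 0 < σ (ι η)
    · left
      refine ⟨Finset.mem_filter.mpr ⟨hηf, hp⟩, fun h => (Finset.mem_filter.mp h).2 hp, ?_⟩
      nlinarith [norm_nonneg α, norm_nonneg β]
    · right
      refine ⟨fun h => hp (Finset.mem_filter.mp h).2, Finset.mem_filter.mpr ⟨hηf, hp⟩, ?_⟩
      have hp' : σ (ι η) < 0 := lt_of_le_of_ne (not_lt.mp hp) (hσne η hη)
      nlinarith [norm_nonneg α, norm_nonneg β]
  have hloc2 : ∀ η : ℂ, ∃ v : ℂ, η ∈ Y → (v ≠ 0 ∧ ∀ L : ℂ → ℂ, Continuous L →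
      Complex.exp (L η) = v →
      ∀ᶠ w in 𝓝 η, 0 ≤ (Nf w * conj (Complex.exp (L w) * conj (qpoly Yp Yn 1 w))).re) := by
    intro η
    by_cases h : η ∈ Y
    · obtain ⟨v, hv⟩ := hloc η h
      exact ⟨v, fun _ => hv⟩
    · exact ⟨0, fun h' => absurd h' h⟩
  choose v hv using hloc2
  obtain ⟨L, hL, hLv⟩ := exists_interp Yf v fun η hη => (hv η (by simpa [hYf] using hη)).1
  obtain ⟨hwc, hwm, hwl⟩ := wrap_facts hs hz.1 hz.2.1 hd.continuousOn hnS hseg hne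
  have hnorm : ∀ x ∈ sphereS, ‖xi x‖ ∈ Icc (0:ℝ) 1 := by
    intro x hx
    have := xi_norm_sq hx
    exact ⟨norm_nonneg _, by nlinarith [norm_nonneg (xi x), sq_nonneg (x 2)]⟩
  have hWι : ∀ x : V3, 0 ≤ x 2 → ι (Wm (zt m 0) x) =
      ‖xi x‖ • z (Complex.arg (xi x)) + (1 - ‖xi x‖) • ctr := by
    intro x hx
    rw [hzm, Wm, kap_up hx, one_mul, hι, iota_mul]
  have hfW : ∀ x : V3, 0 ≤ x 2 → wrapMap n z ctr s x = n (ι (Wm (zt m 0) x)) := by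
    intro x hx
    rw [wrap_up hx, hWι x hx]
  have hη : ∀ η ∈ Yp ∪ Yn, ∀ φ, ∀ l ∈ Icc (0:ℝ) 1, zt m 0 φ ≠ (l : ℂ) * η := by
    intro η hηm φ l hl e
    obtain ⟨h1, h2⟩ := (hmem η).mp hηm
    apply hstar η h1 h2 φ l hl
    rw [hzm, e, hι, iota_mul]
  have hmain : deg (wrapMap n z ctr s) = (Yp.card : ℤ) - (Yn.card : ℤ) := by
    refine core hdeg F hpow hm hmp hη hL hwc hwm ?_ ?_
    · intro x hx
      rcases le_or_gt 0 (x 2) with h | h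
      · rw [hfW x h, hmem]
        constructor
        · intro e
          refine ⟨h, ?_, e⟩
          rw [hWι x h]
          exact hseg _ _ (hnorm x hx)
        · rintro ⟨-, -, e⟩; exact e
      · exact iff_of_false (hwl x hx h) (fun h' => absurd h'.1 (not_le.mpr h))
    · intro y hy hy0 hyW
      have hy2 : 0 < y 2 := by
        rcases hy0.lt_or_eq with h | h
        · exact h
        · exfalso
          refine hη _ hyW (Complex.arg (xi y)) 1 (by simp) ?_
          have h1 : ‖xi y‖ = 1 := by
            have := xi_norm_sq hy
            rw [← h] at this
            nlinarith [norm_nonneg (xi y)]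
          rw [Wm, kap_up hy0, h1]; simp
      have hc : ContinuousAt (fun x => Wm (zt m 0) x) y := by
        have h1 := (Wzt_cont hm hmp).comp (f := fun x : V3 => ((0:ℝ), x)) (s := {x | -1 < x 2})
          (by fun_prop) (fun x hx => ⟨mem_univ _, hx⟩)
        refine h1.continuousAt ((isOpen_lt continuous_const (continuous_apply 2)).mem_nhds ?_)
        change -1 < y 2
        linarith
      have hYW := (hmem _).mp hyW
      have h1 := (hv _ hYW).2 L hL (hLv _ (by rw [← hYu]; exact hyW))
      have h2 := hc.eventually h1
      have h3 : ∀ᶠ x in 𝓝 y, 0 < x 2 :=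
        (isOpen_lt continuous_const (continuous_apply 2)).mem_nhds hy2
      refine mem_nhdsWithin_of_mem_nhds ?_
      filter_upwards [h2, h3] with x hx hx2
      change 0 ≤ (perp a b (wrapMap n z ctr s x) * _).re
      rw [hfW x hx2.le]
      exact hx
  have hιinj : Function.Injective ι := Function.LeftInverse.injective (crd_iota Fe)
  have hZf : hfin.toFinset = Yf.image ι := by
    ext y
    rw [Set.Finite.mem_toFinset, hZim, hYf]
    simp
  have hsum : ∑ y ∈ hfin.toFinset, Real.sign (σ y) = (Yp.card : ℝ) - (Yn.card : ℝ) := by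
    rw [hZf, Finset.sum_image hιinj.injOn, ← Finset.sum_filter_add_sum_filter_not Yf
      (fun η => 0 < σ (ι η))]
    rw [Finset.sum_congr rfl (g := fun _ => (1:ℝ)) (s₂ := Yp), Finset.sum_congr rfl
      (g := fun _ => (-1:ℝ)) (s₂ := Yn)]
    · simp; ring
    · intro η hη
      obtain ⟨h1, h2⟩ := Finset.mem_filter.mp hη
      have h3 : η ∈ Y := by simpa [hYf] using h1
      exact Real.sign_of_neg (lt_of_le_of_ne (not_lt.mp h2) (hσne η h3))
    · intro η hη
      exact Real.sign_of_pos (Finset.mem_filter.mp hη).2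
  rw [hmain, hsum]
  push_cast
  ring

end Helpers

/-- If `s` is a regular value of the restriction of a continuously
differentiable `n̂` to the cleaved face `Ĉ^a`, then the preimage of `s` in `Ĉ^a` is
finite and the wrapping number is the signed count of preimages:
`w^a(n̂) = ∑ sgn det dn̂`. -/
theorem stmt_11 (P : PolyCtx) (deg : (V3 → V3) → ℤ) (hdeg : DegreeTheory deg)
    (s : V3) (hs : P.AdmissibleS s)
    (n : V3 → V3) (hn : P.MemC0Phat n) (hC1 : ContDiffOn ℝ 1 n P.PhatSet)
    (a : Fin P.nv) (w : ℤ) (hw : P.HasWrap deg s a n w)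
    (e₁ e₂ : V3) (he₁ : e₁ ⬝ᵥ e₁ = 1) (he₂ : e₂ ⬝ᵥ e₂ = 1) (he₁₂ : e₁ ⬝ᵥ e₂ = 0)
    (hee : crossProduct e₁ e₂ = P.Cnormal a)
    (hreg : ∀ y ∈ P.Chat a, n y = s →
      crossProduct (fderivWithin ℝ n (P.Chat a) y e₁)
        (fderivWithin ℝ n (P.Chat a) y e₂) ⬝ᵥ s ≠ 0) :
    ∃ hfin : {y ∈ P.Chat a | n y = s}.Finite,
      (w : ℝ) = ∑ y ∈ hfin.toFinset,
        Real.sign (crossProduct (fderivWithin ℝ n (P.Chat a) y e₁)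
          (fderivWithin ℝ n (P.Chat a) y e₂) ⬝ᵥ s) := by
  obtain ⟨ctr, z, hctr, hctrb, hz, hzr, rfl⟩ := hw
  have Fe := frame_of_pair he₁ he₂ he₁₂ hee
  have hsub : P.Chat a ⊆ P.PhatSet := by
    rintro x ⟨h1, h2⟩
    refine ⟨h2, mem_iInter.mpr fun a' => ?_⟩
    exact P.cleave_sub a a' x h2.1 h1
  have hvert : ∀ x, (x - P.cpt a) ⬝ᵥ P.Cnormal a = 0 → x ∉ Set.range P.vert := by
    rintro x hx ⟨a', rfl⟩
    by_cases e : a' = a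
    · subst e; exact absurd hx (P.sep_vert a').ne'
    · exact absurd hx (P.sep_other a a' e).ne
  have hmemC : ∀ x, x ∈ P.Pbar → (x - P.cpt a) ⬝ᵥ P.Cnormal a = 0 → x ∈ P.Chat a :=
    fun x h1 h2 => ⟨h2, h1, hvert x h2⟩
  have hCc : IsCompact (P.Chat a) := by
    have : P.Chat a = P.Pbar ∩ {x | (x - P.cpt a) ⬝ᵥ P.Cnormal a = 0} := by
      ext x
      exact ⟨fun h => ⟨h.2.1, h.1⟩, fun h => hmemC x h.1 h.2⟩
    rw [this]
    refine P.compact.inter_right (isClosed_eq ?_ continuous_const)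
    exact (dot_cont (P.Cnormal a)).comp (continuous_id.sub continuous_const)
  have hctrp : (ctr - P.cpt a) ⬝ᵥ P.Cnormal a = 0 := hctr.1
  have hCp : ∀ y ∈ P.Chat a, (y - ctr) ⬝ᵥ P.Cnormal a = 0 := by
    intro y hy
    have h1 : (y - P.cpt a) ⬝ᵥ P.Cnormal a = 0 := hy.1
    rw [sub_dotProduct] at *
    linarith
  have hzb : ∀ φ, z φ ∈ P.bdChat a := fun φ => by rw [← hzr]; exact mem_range_self φ
  have hzC : ∀ φ, z φ ∈ P.Chat a := by
    intro φ
    obtain ⟨c, hc⟩ := mem_iUnion.mp (hzb φ)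
    exact hc.1
  have htan : ∀ c, ∀ x ∈ P.Fhat c, n x ≠ s := by
    intro c x hx e
    have := hn.2.2 c x hx
    rw [e] at this
    exact hs.2 c this
  have hbd : ∀ x ∈ P.Chat a, x ∉ interior P.Pbar → ∃ c, x ∈ P.Bhat a c := by
    intro x hx hi
    have h1 : x ∈ frontier P.Pbar := ⟨subset_closure hx.2.1, hi⟩
    rw [P.frontier_eq] at h1
    obtain ⟨c, hc⟩ := mem_iUnion.mp h1
    exact ⟨c, hx, hc, (hsub hx).2⟩
  have hctri : ctr ∈ interior P.Pbar := by
    by_contra h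
    obtain ⟨c, hc⟩ := hbd ctr hctr h
    exact hctrb (mem_iUnion.mpr ⟨c, hc⟩)
  have hinter : ∀ y ∈ P.Chat a, n y = s → y ∈ interior P.Pbar := by
    intro y hy e
    by_contra h
    obtain ⟨c, hc⟩ := hbd y hy h
    exact htan c y hc.2 e
  refine planar hdeg hs.1 Fe hz hCc hCp (fun x hx => hn.2.1 x (hsub hx))
    ((hC1.differentiableOn one_ne_zero).mono hsub) ?_ ?_ ?_ ?_ hreg
  · intro φ ρ hρ
    refine hmemC _ ?_ ?_
    · exact P.convex (hzC φ).2.1 hctr.2.1 hρ.1 (by linarith [hρ.2]) (by ring)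
    · have h1 : (z φ - P.cpt a) ⬝ᵥ P.Cnormal a = 0 := (hzC φ).1
      simp only [sub_dotProduct, add_dotProduct, smul_dotProduct, smul_eq_mul] at *
      linear_combination ρ * h1 + (1 - ρ) * hctrp
  · intro φ
    obtain ⟨c, hc⟩ := mem_iUnion.mp (hzb φ)
    exact htan c _ hc.2
  · intro η h1 h2
    have h3 := hinter _ h1 h2
    have h4 : Filter.Eventually (fun w => iota ctr e₁ e₂ w ∈ interior P.Pbar) (nhds η) :=
      (iota_cont ctr e₁ e₂).continuousAt.eventually (isOpen_interior.mem_nhds h3)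
    filter_upwards [h4] with w hw
    refine hmemC _ (interior_subset hw) ?_
    have a1 := Fe.as
    have a2 := Fe.bs
    simp only [iota, sub_dotProduct, add_dotProduct, smul_dotProduct, smul_eq_mul] at *
    rw [a1, a2]
    linarith
  · intro η h1 h2 φ l hl e
    have h3 := hinter _ h1 h2
    have h4 : z φ ∈ interior P.Pbar := by
      rw [e]
      exact P.convex.interior h3 hctri hl.1 (by linarith [hl.2]) (by ring)
    obtain ⟨c, hc⟩ := mem_iUnion.mp (hzb φ)
    have h5 : z φ ∈ frontier P.Pbar := by
      rw [P.frontier_eq]; exact mem_iUnion.mpr ⟨c, hc.2.1⟩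
    exact h5.2 h4
end
end
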